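/- arXiv:2109.13485 — 4 statements merged into one kernel-verified Lean document; each statement's English description precedes it below -/
import Mathlib

section
/- Let k ≥ 2 and let σ and σ' be permutations of {1,…,k} that agree on positions 1,…,k−2, where on the last two positions σ(k−1) = k, σ(k) = k−1 and σ'(k−1) = k−1, σ'(k) = k (so σ is the pattern τ k (k−1) and σ' is the pattern τ (k−1) k for the common prefix τ, which is a permutation of {1,…,k−2}). Then for every n ≥ 0, s_n(σ) = s_n(σ'). -/
/-- `π` contains the pattern `τ`: some subsequence of `π` of length `k` has its
entries in the same relative order as `τ`. -/
def PattContains {k n : ℕ} (τ : Equiv.Perm (Fin k)) (π : Equiv.Perm (Fin n)) : Prop :=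
  ∃ f : Fin k → Fin n, StrictMono f ∧ ∀ a b : Fin k, π (f a) < π (f b) ↔ τ a < τ b

/-- `avoidCount τ n` is the number of permutations of `{1, …, n}` avoiding the
pattern `τ`. -/
noncomputable def avoidCount {k : ℕ} (τ : Equiv.Perm (Fin k)) (n : ℕ) : ℕ :=
  Nat.card {π : Equiv.Perm (Fin n) // ¬ PattContains τ π}

/-- The cell `(x, y)` has, strictly to its left and strictly below it, a subsequence of `π`
whose entries are in the same relative order as those of `t`. -/
def Dominates {m n : ℕ} (t : Fin m → ℕ) (π : Equiv.Perm (Fin n)) (x y : Fin n) : Prop :=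
  ∃ f : Fin m → Fin n, StrictMono f ∧ (∀ a b, π (f a) < π (f b) ↔ t a < t b) ∧
    ∀ a, f a < x ∧ π (f a) < y

namespace Dominates

variable {m n : ℕ} {t : Fin m → ℕ} {π ρ : Equiv.Perm (Fin n)} {x y x' y' : Fin n}

theorem mono (h : Dominates t π x y) (hx : x ≤ x') (hy : y ≤ y') : Dominates t π x' y' := by
  obtain ⟨f, hf, hp, hd⟩ := h
  exact ⟨f, hf, hp, fun a => ⟨(hd a).1.trans_le hx, (hd a).2.trans_le hy⟩⟩

/-- The subsequence witnessing `Dominates` can be chosen among entries that are not themselves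
dominating. -/
theorem exists_minimal (h : Dominates t π x y) :
    ∃ f : Fin m → Fin n, StrictMono f ∧ (∀ a b, π (f a) < π (f b) ↔ t a < t b) ∧
      (∀ a, f a < x ∧ π (f a) < y) ∧ ∀ a, ¬ Dominates t π (f a) (π (f a)) := by
  induction x using WellFoundedLT.induction generalizing y with
  | ind x ih =>
    obtain ⟨f, hf, hp, hd⟩ := h
    by_cases hc : ∃ a, Dominates t π (f a) (π (f a))
    · obtain ⟨a, ha⟩ := hc
      obtain ⟨g, hg, hgp, hgd, hgm⟩ := ih (f a) (hd a).1 ha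
      exact ⟨g, hg, hgp, fun b => ⟨(hgd b).1.trans (hd a).1, (hgd b).2.trans (hd a).2⟩, hgm⟩
    · exact ⟨f, hf, hp, hd, not_exists.mp hc⟩

theorem of_eq_off (hρ : ∀ i, ¬ Dominates t π i (π i) → π i = ρ i) (h : Dominates t π x y) :
    Dominates t ρ x y := by
  obtain ⟨f, hf, hp, hd, hm⟩ := h.exists_minimal
  have e : ∀ a, ρ (f a) = π (f a) := fun a => (hρ _ (hm a)).symm
  exact ⟨f, hf, by simpa only [e] using hp, by simpa only [e] using hd⟩

end Dominates

/-- `ρ` is obtained from `π` by rearranging dominating entries within the region of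
dominating cells. -/
def Rearranges {m n : ℕ} (t : Fin m → ℕ) (π ρ : Equiv.Perm (Fin n)) : Prop :=
  ∀ i, π i = ρ i ∨ (Dominates t π i (π i) ∧ Dominates t π i (ρ i))

namespace Rearranges

variable {m n : ℕ} {t : Fin m → ℕ} {π ρ : Equiv.Perm (Fin n)}

theorem dominates_iff (h : Rearranges t π ρ) (x y : Fin n) :
    Dominates t π x y ↔ Dominates t ρ x y := by
  have key : ∀ {x y}, Dominates t π x y → Dominates t ρ x y :=
    Dominates.of_eq_off fun i hi => (h i).resolve_right fun h' => hi h'.1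
  exact ⟨key, Dominates.of_eq_off fun i hi =>
    ((h i).resolve_right fun h' => hi (key h'.2)).symm⟩

theorem equivalence (t : Fin m → ℕ) : Equivalence (Rearranges (n := n) t) where
  refl _ _ := Or.inl rfl
  symm := by
    intro π ρ h i
    simp only [← h.dominates_iff]
    exact (h i).imp Eq.symm And.symm
  trans := by
    intro π ρ μ h h' i
    have h'' := h' i
    simp only [← h.dominates_iff] at h''
    rcases h i with e | e <;> rcases h'' with e' | e'
    · exact Or.inl (e.trans e')
    · exact Or.inr ⟨e ▸ e'.1, e'.2⟩
    · exact Or.inr ⟨e.1, e' ▸ e.2⟩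
    · exact Or.inr ⟨e.1, e'.2⟩

theorem mul_swap {p q : Fin n} (hpq : p < q) (h : Dominates t π p (min (π p) (π q))) :
    Rearranges t π (π * Equiv.swap p q) := by
  intro i
  by_cases hp : i = p
  · subst hp
    right
    simpa using ⟨h.mono le_rfl (min_le_left _ _), h.mono le_rfl (min_le_right _ _)⟩
  by_cases hq : i = q
  · subst hq
    right
    simpa using ⟨h.mono hpq.le (min_le_right _ _), h.mono hpq.le (min_le_left _ _)⟩
  · left
    simp [Equiv.swap_apply_of_ne_of_ne hp hq]

end Rearranges

/-- A pattern ending in its two largest entries occurs in `π` iff the last two entries can be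
chosen in the right order with the prefix to the left of and below both. -/
theorem pattContains_iff_exists_dominates {m n : ℕ} (s : Equiv.Perm (Fin (m + 2)))
    (hs : ∀ i : Fin m, s i.castSucc.castSucc < s (Fin.last m).castSucc ∧
      s i.castSucc.castSucc < s (Fin.last (m + 1))) (π : Equiv.Perm (Fin n)) :
    PattContains s π ↔ ∃ p q, p < q ∧
      (π p < π q ↔ s (Fin.last m).castSucc < s (Fin.last (m + 1))) ∧
      Dominates (fun i => (s i.castSucc.castSucc : ℕ)) π p (min (π p) (π q)) := by
  constructor
  · rintro ⟨f, hf, hp⟩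
    refine ⟨f (Fin.last m).castSucc, f (Fin.last (m + 1)), hf (Fin.castSucc_lt_last _),
      hp _ _, fun i => f i.castSucc.castSucc, ?_, fun a b => hp _ _, fun a => ⟨?_, ?_⟩⟩
    · intro a b hab
      exact hf (by simpa using hab)
    · exact hf (by simp)
    · exact lt_min ((hp _ _).2 (hs a).1) ((hp _ _).2 (hs a).2)
  · rintro ⟨p, q, hpq, ho, g, hg, hgp, hgd⟩
    have hne : π p ≠ π q := fun h => hpq.ne (π.injective h)
    have hne' : s (Fin.last m).castSucc ≠ s (Fin.last (m + 1)) := fun h =>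
      (Fin.castSucc_lt_last (Fin.last m)).ne (s.injective h)
    have hd : ∀ a, π (g a) < π p ∧ π (g a) < π q := fun a => lt_min_iff.1 (hgd a).2
    refine ⟨Fin.snoc (α := fun _ => Fin n) (Fin.snoc (α := fun _ => Fin n) g p) q, ?_, ?_⟩
    · intro a b hab
      induction a using Fin.lastCases with
      | last => exact absurd hab (Fin.le_last b).not_gt
      | cast a =>
        induction b using Fin.lastCases with
        | last =>
          induction a using Fin.lastCases with
          | last => simpa using hpq
          | cast a => simpa using (hgd a).1.trans hpq
        | cast b =>
          induction a using Fin.lastCases with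
          | last => exact absurd (Fin.castSucc_lt_castSucc_iff.1 hab) (Fin.le_last b).not_gt
          | cast a =>
            induction b using Fin.lastCases with
            | last => simpa using (hgd a).1
            | cast b => simpa using hg (by simpa using hab)
    · intro a b
      induction a using Fin.lastCases with
      | last =>
        induction b using Fin.lastCases with
        | last => simp
        | cast b =>
          induction b using Fin.lastCases with
          | last => simp; grind
          | cast b => simp [(hd b).2.not_gt, (hs b).2.not_gt]
      | cast a =>
        induction b using Fin.lastCases with
        | last =>
          induction a using Fin.lastCases with
          | last => simpa using ho
          | cast a => simp [(hd a).2, (hs a).2]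
        | cast b =>
          induction a using Fin.lastCases with
          | last =>
            induction b using Fin.lastCases with
            | last => simp
            | cast b => simp [(hd b).1.not_gt, (hs b).1.not_gt]
          | cast a =>
            induction b using Fin.lastCases with
            | last => simp [(hd a).1, (hs a).1]
            | cast b => simpa using hgp a b

theorem sum_mul_swap_sub {n : ℕ} (π : Equiv.Perm (Fin n)) {p q : Fin n} (hpq : p ≠ q) :
    ∑ i : Fin n, (i : ℤ) * ((π * Equiv.swap p q) i : ℤ) - ∑ i : Fin n, (i : ℤ) * (π i : ℤ) =
      ((p : ℤ) - q) * ((π q : ℤ) - π p) := by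
  rw [← Finset.sum_sub_distrib, ← Finset.sum_subset (Finset.subset_univ {p, q}),
    Finset.sum_pair hpq]
  · simp
    ring
  · intro i _ hi
    simp only [Finset.mem_insert, Finset.mem_singleton, not_or] at hi
    simp [Equiv.swap_apply_of_ne_of_ne hi.1 hi.2]

theorem Rearranges.exists_forall_not {m n : ℕ} (t : Fin m → ℕ) (up : Prop)
    (π : Equiv.Perm (Fin n)) :
    ∃ ρ, Rearranges t π ρ ∧ ¬ ∃ p q, p < q ∧ (ρ p < ρ q ↔ up) ∧
      Dominates t ρ p (min (ρ p) (ρ q)) := by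
  classical
  let c : ℤ := if up then 1 else -1
  have : Nonempty {ρ // Rearranges t π ρ} := ⟨⟨π, (Rearranges.equivalence t).refl π⟩⟩
  obtain ⟨⟨ρ, hρ⟩, hmin⟩ := Finite.exists_min
    fun ρ : {ρ // Rearranges t π ρ} => c * ∑ i : Fin n, (i : ℤ) * (ρ.1 i : ℤ)
  refine ⟨ρ, hρ, ?_⟩
  rintro ⟨p, q, hpq, ho, hd⟩
  have h := hmin ⟨_, (Rearranges.equivalence t).trans hρ (Rearranges.mul_swap hpq hd)⟩
  have hs := sum_mul_swap_sub ρ hpq.ne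
  have hpq' : (p : ℤ) < q := by exact_mod_cast hpq
  simp only at h
  by_cases hu : up
  · have h1 : (ρ p : ℤ) < ρ q := by exact_mod_cast ho.2 hu
    simp only [c, hu, if_true, one_mul] at h
    nlinarith
  · have h1 : (ρ q : ℤ) < ρ p := by
      have := lt_of_le_of_ne (not_lt.1 (mt ho.1 hu)) fun h => hpq.ne' (ρ.injective h)
      exact_mod_cast this
    simp only [c, hu, if_false] at h
    nlinarith

theorem Rearranges.eq_of_forall_not {m n : ℕ} {t : Fin m → ℕ} {up : Prop}
    {π ρ : Equiv.Perm (Fin n)} (h : Rearranges t π ρ)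
    (hπ : ¬ ∃ p q, p < q ∧ (π p < π q ↔ up) ∧ Dominates t π p (min (π p) (π q)))
    (hρ : ¬ ∃ p q, p < q ∧ (ρ p < ρ q ↔ up) ∧ Dominates t ρ p (min (ρ p) (ρ q))) :
    π = ρ := by
  have agree : ∀ i, π i = ρ i := by
    intro p
    induction p using WellFoundedLT.induction with
    | ind p ih =>
      by_contra hne
      have later : ∀ {μ ν : Equiv.Perm (Fin n)}, (∀ i < p, μ i = ν i) → μ p ≠ ν p →
          p < μ.symm (ν p) := by
        intro μ ν hμν hn
        by_contra! hle
        rcases hle.lt_or_eq with hlt | heq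
        · have := hμν _ hlt
          rw [Equiv.apply_symm_apply] at this
          exact hlt.ne (ν.injective this).symm
        · exact hn (by rw [← heq, Equiv.apply_symm_apply, heq])
      have hq := later ih hne
      have hq' := later (fun i hi => (ih i hi).symm) (Ne.symm hne)
      obtain ⟨d1, d2⟩ := (h p).resolve_left hne
      have dmin : Dominates t π p (min (π p) (ρ p)) := by
        rcases min_choice (π p) (ρ p) with e | e <;> rwa [e]
      by_cases hu : (π p < ρ p ↔ up)
      · exact hπ ⟨p, _, hq, by simpa using hu, by simpa using dmin⟩
      · refine hρ ⟨p, _, hq', ?_, ?_⟩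
        · rw [Equiv.apply_symm_apply]
          have : ρ p < π p ↔ ¬ π p < ρ p := by
            rw [not_lt]
            exact ⟨le_of_lt, fun h => lt_of_le_of_ne h (Ne.symm hne)⟩
          tauto
        · rw [Equiv.apply_symm_apply, min_comm]
          exact (h.dominates_iff _ _).1 dmin
  exact Equiv.ext agree

/-- Avoiders of a pattern ending in its two largest entries are counted by the classes of
`Rearranges` for the prefix, regardless of the order of the last two entries. -/
theorem avoidCount_eq_card_quotient {m : ℕ} (s : Equiv.Perm (Fin (m + 2)))
    (hs : ∀ i : Fin m, s i.castSucc.castSucc < s (Fin.last m).castSucc ∧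
      s i.castSucc.castSucc < s (Fin.last (m + 1))) (n : ℕ) :
    avoidCount s n = Nat.card (Quotient (Setoid.mk _
      (Rearranges.equivalence (n := n) fun i : Fin m => (s i.castSucc.castSucc : ℕ)))) := by
  refine Nat.card_eq_of_bijective (fun π => Quotient.mk _ π.1) ⟨?_, ?_⟩
  · rintro ⟨π, hπ⟩ ⟨ρ, hρ⟩ h
    rw [pattContains_iff_exists_dominates s hs] at hπ hρ
    exact Subtype.ext (Rearranges.eq_of_forall_not (Quotient.exact h) hπ hρ)
  · intro c
    induction c using Quotient.inductionOn with
    | h π =>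
      obtain ⟨ρ, hr, hρ⟩ := Rearranges.exists_forall_not
        (fun i : Fin m => (s i.castSucc.castSucc : ℕ))
        (s (Fin.last m).castSucc < s (Fin.last (m + 1))) π
      exact ⟨⟨ρ, by rwa [pattContains_iff_exists_dominates s hs]⟩,
        Quotient.sound ((Rearranges.equivalence _).symm hr)⟩

/-- The patterns `τ k (k-1)` and `τ (k-1) k` are Wilf-equivalent: if `σ, σ'` are
permutations of `{1,…,k}` (0-indexed as `Perm (Fin k)`) agreeing on the first
`k-2` positions, with `σ` ending in the values `k, k-1` and `σ'` ending in the
values `k-1, k` (0-indexed: `k-1, k-2` resp. `k-2, k-1`), then `σ` and `σ'` are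
avoided by equally many permutations of each length. -/
theorem stmt_15 (k : ℕ) (hk : 2 ≤ k) (σ σ' : Equiv.Perm (Fin k))
    (hagree : ∀ i : Fin k, (i : ℕ) < k - 2 → σ i = σ' i)
    (h1 : ∀ i : Fin k, (i : ℕ) = k - 2 → (σ i : ℕ) = k - 1 ∧ (σ' i : ℕ) = k - 2)
    (h2 : ∀ i : Fin k, (i : ℕ) = k - 1 → (σ i : ℕ) = k - 2 ∧ (σ' i : ℕ) = k - 1) :
    ∀ n : ℕ, avoidCount σ n = avoidCount σ' n := by
  intro n
  obtain ⟨m, rfl⟩ := Nat.exists_eq_add_of_le' hk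
  have e1 := h1 (Fin.last m).castSucc (by simp)
  have e2 := h2 (Fin.last (m + 1)) (by simp)
  have e : ∀ i : Fin m, σ i.castSucc.castSucc = σ' i.castSucc.castSucc := fun i =>
    hagree _ (by simp)
  have n1 : ∀ i : Fin m, (σ i.castSucc.castSucc : ℕ) ≠ σ (Fin.last m).castSucc := by
    intro i h
    have := congrArg Fin.val (σ.injective (Fin.ext h))
    simp at this
    omega
  have n2 : ∀ i : Fin m, (σ i.castSucc.castSucc : ℕ) ≠ σ (Fin.last (m + 1)) := by
    intro i h
    have := congrArg Fin.val (σ.injective (Fin.ext h))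
    simp at this
    omega
  have hlt : ∀ i : Fin m, (σ i.castSucc.castSucc : ℕ) < m := by
    intro i
    have := n1 i
    have := n2 i
    have := (σ i.castSucc.castSucc).isLt
    omega
  rw [avoidCount_eq_card_quotient σ, avoidCount_eq_card_quotient σ']
  · simp only [e]
  · intro i
    have := hlt i
    rw [e] at this
    simp only [Fin.lt_def]
    omega
  · intro i
    have := hlt i
    simp only [Fin.lt_def]
    omega
end

section
/- (Stankova–West) For every assignment of the values {1,2} to (n_4, n_5) (i.e. (n_4,n_5) = (1,2) or (2,1)) and every n ≥ 0, the length-5 patterns 3 5 4 n_4 n_5 and 4 3 5 n_4 n_5 are equinumerously avoided: s_n(35 4 n_4 n_5) = s_n(4 3 5 n_4 n_5), where the pattern a b c d e denotes the permutation of {1,…,5} sending 1↦a, 2↦b, 3↦c, 4↦d, 5↦e. -/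
/-- The reflection of a permutation in the antidiagonal: the point `(i, v)` of its graph
is sent to `(rev v, rev i)`. -/
def antidiagReflect {n : ℕ} (π : Equiv.Perm (Fin n)) : Equiv.Perm (Fin n) :=
  Fin.revPerm.trans (π.symm.trans Fin.revPerm)

theorem antidiagReflect_apply {n : ℕ} (π : Equiv.Perm (Fin n)) (i : Fin n) :
    antidiagReflect π i = (π.symm i.rev).rev := rfl

theorem antidiagReflect_apply_rev {n : ℕ} (π : Equiv.Perm (Fin n)) (i : Fin n) :
    antidiagReflect π (π i).rev = i.rev := by
  simp [antidiagReflect_apply]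

theorem antidiagReflect_eq_of_forall {n : ℕ} {π ρ : Equiv.Perm (Fin n)}
    (h : ∀ i, ρ (π i).rev = i.rev) : antidiagReflect π = ρ := by
  refine Equiv.ext fun i => ?_
  rw [antidiagReflect_apply, ← h, Equiv.apply_symm_apply, Fin.rev_rev]

theorem antidiagReflect_involutive {n : ℕ} :
    Function.Involutive (antidiagReflect : Equiv.Perm (Fin n) → Equiv.Perm (Fin n)) :=
  fun π => antidiagReflect_eq_of_forall fun i => by simp [antidiagReflect_apply]

theorem PattContains.antidiagReflect {k n : ℕ} {τ : Equiv.Perm (Fin k)}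
    {π : Equiv.Perm (Fin n)} (h : PattContains τ π) :
    PattContains (antidiagReflect τ) (antidiagReflect π) := by
  obtain ⟨f, hf, hτ⟩ := h
  refine ⟨fun a => (π (f (τ.symm a.rev))).rev, fun a b hab => ?_, fun a b => ?_⟩
  · rw [Fin.rev_lt_rev, hτ]
    simpa using hab
  · rw [antidiagReflect_apply_rev, antidiagReflect_apply_rev, Fin.rev_lt_rev, hf.lt_iff_lt,
      antidiagReflect_apply, antidiagReflect_apply, Fin.rev_lt_rev]

theorem pattContains_antidiagReflect_iff {k n : ℕ} {τ : Equiv.Perm (Fin k)}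
    {π : Equiv.Perm (Fin n)} :
    PattContains (antidiagReflect τ) (antidiagReflect π) ↔ PattContains τ π := by
  refine ⟨fun h => ?_, PattContains.antidiagReflect⟩
  simpa only [antidiagReflect_involutive _] using h.antidiagReflect

theorem avoidCount_antidiagReflect {k : ℕ} (τ : Equiv.Perm (Fin k)) (n : ℕ) :
    avoidCount (antidiagReflect τ) n = avoidCount τ n :=
  (Nat.card_congr (antidiagReflect_involutive.toPerm.subtypeEquiv fun _ =>
    not_congr pattContains_antidiagReflect_iff.symm)).symm

/-- Stankova–West: for each assignment of the values `{1,2}` to the last two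
entries `(n₄, n₅)`, the length-5 patterns `3 5 4 n₄ n₅` and `4 3 5 n₄ n₅` are
equinumerously avoided.  Here `σ` is the pattern `3 5 4 n₄ n₅` and `σ'` is the
pattern `4 3 5 n₄ n₅` (written 0-indexed on `Fin 5`, so the initial segments take
the values `2 4 3` and `3 2 4`, the common tail values being `{0, 1}` in either
order). -/
theorem stmt_16 (σ σ' : Equiv.Perm (Fin 5))
    (hσ : σ 0 = 2 ∧ σ 1 = 4 ∧ σ 2 = 3)
    (hσ' : σ' 0 = 3 ∧ σ' 1 = 2 ∧ σ' 2 = 4)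
    (htail : σ 3 = σ' 3 ∧ σ 4 = σ' 4)
    (hvals : (σ 3 = 0 ∧ σ 4 = 1) ∨ (σ 3 = 1 ∧ σ 4 = 0)) :
    ∀ n : ℕ, avoidCount σ n = avoidCount σ' n := by
  obtain ⟨h0, h1, h2⟩ := hσ
  obtain ⟨h0', h1', h2'⟩ := hσ'
  obtain ⟨h3, h4⟩ := htail
  have key : antidiagReflect σ = σ' := by
    refine antidiagReflect_eq_of_forall fun i => ?_
    rcases hvals with ⟨v3, v4⟩ | ⟨v3, v4⟩ <;>
      have v3' := h3.symm.trans v3 <;> have v4' := h4.symm.trans v4 <;>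
      fin_cases i <;> simp only [Fin.zero_eta, Fin.mk_one, Fin.reduceFinMk, *] <;> assumption
  intro n
  rw [← key, avoidCount_antidiagReflect]
end

section
/- The sequence (s_n(12345))_{n≥0} of numbers of permutations of {1,…,n} avoiding the pattern 12345 (with s_0 = 1) is a Stieltjes moment sequence: there exists a Borel measure ρ on ℝ supported on [0,∞), with finite moments of all orders, such that s_n(12345) = ∫ x^n dρ(x) for all n ≥ 0. -/
open MeasureTheory

/-- The pattern `12345`, i.e. the identity permutation of `{1,…,5}`. -/
def patt12345 : Equiv.Perm (Fin 5) := Equiv.refl (Fin 5)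

/-- `IsPartition a` says that `a` is the sequence of parts of an integer partition. -/
def IsPartition (a : ℕ → ℕ) : Prop := Antitone a ∧ ∃ N, a N = 0

/-- `b` is equal to `a` or is obtained from `a` by adding one box. -/
def BoxStep (a b : ℕ → ℕ) : Prop := b = a ∨ ∃ i, b = a + Pi.single i 1

theorem BoxStep.le {a b : ℕ → ℕ} (h : BoxStep a b) : a ≤ b := by
  obtain rfl | ⟨i, rfl⟩ := h
  · exact le_rfl
  · exact le_self_add

/-- Fomin's local rule for a unit square of a growth diagram, in the variant in which the number
of parts records the longest increasing subsequence. The corners are listed in the order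
`(0, 0)`, `(1, 0)`, `(0, 1)`, `(1, 1)`; the flag says whether the square carries a point. -/
inductive LocalRule : Bool → (ℕ → ℕ) → (ℕ → ℕ) → (ℕ → ℕ) → (ℕ → ℕ) → Prop
  | left {r b : ℕ → ℕ} (h : BoxStep r b) : LocalRule false r r b b
  | right {r b : ℕ → ℕ} (h : BoxStep r b) : LocalRule false r b r b
  | diag {r : ℕ → ℕ} {i j : ℕ} (h : i ≠ j) :
      LocalRule false r (r + Pi.single i 1) (r + Pi.single j 1)
        (r + Pi.single i 1 + Pi.single j 1)
  | bump {r : ℕ → ℕ} {i j : ℕ} (h : r j + (Pi.single i 1 : ℕ → ℕ) j = r i + 1) :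
      LocalRule false r (r + Pi.single i 1) (r + Pi.single i 1)
        (r + Pi.single i 1 + Pi.single j 1)
  | point {r : ℕ → ℕ} {j : ℕ} (h : r j = 0) : LocalRule true r r r (r + Pi.single j 1)

namespace LocalRule

variable {x y : Bool} {r r' a b c c' : ℕ → ℕ}

theorem symm (h : LocalRule x r a b c) : LocalRule x r b a c := by
  cases h with
  | left h => exact .right h
  | right h => exact .left h
  | diag h =>
    rw [add_right_comm]
    exact .diag h.symm
  | bump h => exact .bump h
  | point h => exact .point h

theorem step_right (h : LocalRule x r a b c) : BoxStep a c := by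
  cases h with
  | left h => exact h
  | right h => exact .inl rfl
  | diag h => exact .inr ⟨_, rfl⟩
  | bump h => exact .inr ⟨_, rfl⟩
  | point h => exact .inr ⟨_, rfl⟩

theorem step_bot (h : LocalRule x r a b c) : BoxStep r a := by
  cases h with
  | left h => exact .inl rfl
  | right h => exact h
  | diag h => exact .inr ⟨_, rfl⟩
  | bump h => exact .inr ⟨_, rfl⟩
  | point h => exact .inl rfl

theorem step_left (h : LocalRule x r a b c) : BoxStep r b := h.symm.step_bot

theorem step_top (h : LocalRule x r a b c) : BoxStep b c := h.symm.step_right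

end LocalRule

theorem add_single_ne_self (a : ℕ → ℕ) (i : ℕ) : a + Pi.single i 1 ≠ a := fun h => by
  simpa using congrFun h i

theorem add_single_sup {a : ℕ → ℕ} {i j : ℕ} (h : i ≠ j) :
    (a + Pi.single i 1) ⊔ (a + Pi.single j 1) = a + Pi.single i 1 + Pi.single j 1 := by
  ext t
  simp only [Pi.sup_apply, Pi.add_apply, Pi.single_apply]
  split_ifs <;> omega

theorem add_single_inf {a : ℕ → ℕ} {i j : ℕ} (h : i ≠ j) :
    (a + Pi.single i 1) ⊓ (a + Pi.single j 1) = a := by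
  ext t
  simp only [Pi.inf_apply, Pi.add_apply, Pi.single_apply]
  split_ifs <;> omega

theorem single_one_inj {i j : ℕ} : (Pi.single i 1 : ℕ → ℕ) = Pi.single j 1 ↔ i = j := by
  refine ⟨fun h => ?_, fun h => h ▸ rfl⟩
  by_contra hij
  simpa [Pi.single_apply, hij] using congrFun h i

namespace LocalRule
variable {x y : Bool} {r r' a b c c' : ℕ → ℕ}

theorem eq_right_iff (h : LocalRule x r a b c) : c = a ↔ b = r ∧ x = false := by
  cases h <;> simp

theorem eq_top_iff (h : LocalRule x r a b c) : c = b ↔ a = r ∧ x = false := h.symm.eq_right_iff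

theorem eq_of_point (h : LocalRule true r a b c) : a = r ∧ b = r := by
  cases h; simp

end LocalRule

theorem eq_of_antitone_add_single {a : ℕ → ℕ} {i j : ℕ} (hi : Antitone (a + Pi.single i 1))
    (hj : Antitone (a + Pi.single j 1)) (h : a i = a j) : i = j := by
  by_contra hij
  rcases lt_or_gt_of_ne hij with hlt | hlt
  · have := hj hlt.le
    simp [hij] at this
    omega
  · have := hi hlt.le
    simp [Ne.symm hij] at this
    omega

theorem eq_of_antitone_of_add_single {r r' : ℕ → ℕ} {i j : ℕ} (hr : Antitone r)
    (hr' : Antitone r') (h : r + Pi.single i 1 = r' + Pi.single j 1) (hij : r i = r' j) :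
    i = j := by
  by_contra hne
  have h1 := congrFun h i
  have h2 := congrFun h j
  simp [hne, Ne.symm hne] at h1 h2
  rcases lt_or_gt_of_ne hne with hlt | hlt
  · have := hr hlt.le
    omega
  · have := hr' hlt.le
    omega

namespace LocalRule
variable {x y : Bool} {r r' a b c c' : ℕ → ℕ}


theorem of_ne (h : LocalRule x r a b c) (hab : a ≠ b) : x = false ∧ r = a ⊓ b ∧ c = a ⊔ b := by
  cases h with
  | left h => exact ⟨rfl, (inf_eq_left.2 (h.le)).symm, (sup_eq_right.2 (h.le)).symm⟩
  | right h => exact ⟨rfl, (inf_eq_right.2 (h.le)).symm, (sup_eq_left.2 (h.le)).symm⟩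
  | diag h => exact ⟨rfl, (add_single_inf h).symm, (add_single_sup h).symm⟩
  | bump h => exact absurd rfl hab
  | point h => exact absurd rfl hab

theorem of_eq (h : LocalRule x r a b c) (hab : a = b) :
    (x = false ∧ r = a ∧ c = a) ∨
    (x = false ∧ ∃ i j, a = r + Pi.single i 1 ∧ c = a + Pi.single j 1 ∧ a i = a j) ∨
    (x = true ∧ r = a ∧ ∃ j, c = a + Pi.single j 1 ∧ a j = 0) := by
  cases h with
  | left h => exact .inl ⟨rfl, rfl, hab.symm⟩
  | right h => exact .inl ⟨rfl, hab.symm, rfl⟩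
  | diag h => exact absurd (single_one_inj.1 (add_left_cancel hab)) h
  | bump h => exact .inr (.inl ⟨rfl, _, _, rfl, rfl, by simpa using h.symm⟩)
  | point h => exact .inr (.inr ⟨rfl, rfl, _, rfl, h⟩)

theorem unique_forward (hc : Antitone c) (hc' : Antitone c') (h : LocalRule x r a b c)
    (h' : LocalRule x r a b c') : c = c' := by
  by_cases hab : a = b
  · subst hab
    rcases h.of_eq rfl with ⟨h0, h1, h2⟩ | ⟨h0, i, j, h1, h2, h3⟩ | ⟨h0, h1, j, h2, h3⟩ <;>
    rcases h'.of_eq rfl with ⟨h0', h1', h2'⟩ | ⟨h0', i', j', h1', h2', h3'⟩ | ⟨h0', h1', j', h2', h3'⟩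
    · rw [h2, h2']
    · exact absurd (h1'.symm.trans h1.symm) (add_single_ne_self _ _)
    · exact absurd (h0.symm.trans h0') (by decide)
    · exact absurd (h1.symm.trans h1'.symm) (add_single_ne_self _ _)
    · obtain rfl := single_one_inj.1 (add_left_cancel (h1.symm.trans h1'))
      subst h2 h2'
      rw [eq_of_antitone_add_single hc hc' (h3.symm.trans h3')]
    · exact absurd (h0.symm.trans h0') (by decide)
    · exact absurd (h0.symm.trans h0') (by decide)
    · exact absurd (h0.symm.trans h0') (by decide)
    · subst h2 h2'
      rw [eq_of_antitone_add_single hc hc' (h3.trans h3'.symm)]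
  · rw [(h.of_ne hab).2.2, (h'.of_ne hab).2.2]

theorem unique_backward (hr : Antitone r) (hr' : Antitone r') (h : LocalRule x r a b c)
    (h' : LocalRule y r' a b c) : x = y ∧ r = r' := by
  by_cases hab : a = b
  · subst hab
    rcases h.of_eq rfl with ⟨h0, h1, h2⟩ | ⟨h0, i, j, h1, h2, h3⟩ | ⟨h0, h1, j, h2, h3⟩ <;>
    rcases h'.of_eq rfl with ⟨h0', h1', h2'⟩ | ⟨h0', i', j', h1', h2', h3'⟩ | ⟨h0', h1', j', h2', h3'⟩
    · exact ⟨h0.trans h0'.symm, h1.trans h1'.symm⟩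
    · exact absurd (h2'.symm.trans h2) (add_single_ne_self _ _)
    · exact absurd (h2'.symm.trans h2) (add_single_ne_self _ _)
    · exact absurd (h2.symm.trans h2') (add_single_ne_self _ _)
    · obtain rfl := single_one_inj.1 (add_left_cancel (h2.symm.trans h2'))
      have hii : i = i' := by
        refine eq_of_antitone_of_add_single hr hr' (h1.symm.trans h1') ?_
        have e1 := congrFun h1 i
        have e2 := congrFun h1' i'
        simp at e1 e2
        omega
      subst hii
      exact ⟨h0.trans h0'.symm, add_right_cancel (h1.symm.trans h1')⟩
    · obtain rfl := single_one_inj.1 (add_left_cancel (h2.symm.trans h2'))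
      have e1 := congrFun h1 i
      simp at e1
      omega
    · exact absurd (h2.symm.trans h2') (add_single_ne_self _ _)
    · obtain rfl := single_one_inj.1 (add_left_cancel (h2.symm.trans h2'))
      have e1 := congrFun h1' i'
      simp at e1
      omega
    · exact ⟨h0.trans h0'.symm, h1.trans h1'.symm⟩
  · have e := h.of_ne hab
    have e' := h'.of_ne hab
    exact ⟨e.1.trans e'.1.symm, e.2.1.trans e'.2.1.symm⟩

end LocalRule

theorem IsPartition.of_le {a b : ℕ → ℕ} (hb : IsPartition b) (ha : Antitone a) (h : a ≤ b) :
    IsPartition a := by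
  obtain ⟨N, hN⟩ := hb.2
  exact ⟨ha, N, by have : a N ≤ b N := h N; omega⟩

/-- A box can be added to a partition at the first part equal to a given value. -/
theorem IsPartition.exists_add {a : ℕ → ℕ} (ha : IsPartition a) {v : ℕ} (hv : ∃ i, a i = v) :
    ∃ j, a j = v ∧ IsPartition (a + Pi.single j 1) := by
  classical
  refine ⟨Nat.find hv, Nat.find_spec hv, ?_, ?_⟩
  · refine antitone_nat_of_succ_le fun t => ?_
    have h1 := ha.1 (Nat.le_add_right t 1)
    have h2 := Nat.find_spec hv
    have h3 := fun m => @Nat.find_min _ _ hv m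
    by_cases ht : t + 1 = Nat.find hv
    · have h4 := h3 t (by omega)
      rw [← ht] at h2 ⊢
      simp
      omega
    · have : (Pi.single (Nat.find hv) 1 : ℕ → ℕ) (t + 1) = 0 := by simp [ht]
      simp only [Pi.add_apply, this]
      omega
  · obtain ⟨N, hN⟩ := ha.2
    refine ⟨max N (Nat.find hv + 1), ?_⟩
    have := ha.1 (le_max_left N (Nat.find hv + 1))
    have h2 : max N (Nat.find hv + 1) ≠ Nat.find hv := by omega
    simp [h2]
    omega

/-- A box can be removed from a partition at the last part equal to a given positive value. -/
theorem IsPartition.exists_sub {a : ℕ → ℕ} (ha : IsPartition a) {j : ℕ} (hv : 0 < a j) :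
    ∃ i r, a i = a j ∧ IsPartition r ∧ a = r + Pi.single i 1 := by
  classical
  have hex : ∃ i, a (i + 1) < a j := by
    obtain ⟨N, hN⟩ := ha.2
    exact ⟨N, by have := ha.1 (Nat.le_add_right N 1); omega⟩
  have h2 := Nat.find_spec hex
  have h3 := fun m => @Nat.find_min _ _ hex m
  set i := Nat.find hex with hi
  have hji : j ≤ i := by
    by_contra hlt
    have := ha.1 (show i + 1 ≤ j by omega)
    omega
  have hai : a i = a j := by
    rcases Nat.eq_zero_or_pos i with h0 | h0
    · rw [show i = j by omega]
    · have h4 := h3 (i - 1) (by omega)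
      rw [Nat.sub_add_cancel h0] at h4
      have := ha.1 hji
      omega
  have hr : a = (a - Pi.single i 1) + Pi.single i 1 := by
    ext t
    by_cases ht : t = i
    · subst ht; simp; omega
    · simp [ht]
  refine ⟨i, a - Pi.single i 1, hai, ha.of_le ?_ tsub_le_self, hr⟩
  refine antitone_nat_of_succ_le fun t => ?_
  have h1 := ha.1 (Nat.le_add_right t 1)
  by_cases ht : t = i
  · subst ht
    simp
    omega
  · have : (Pi.single i 1 : ℕ → ℕ) t = 0 := by simp [ht]
    simp only [Pi.sub_apply, this]
    omega

theorem exists_localRule_forward {x : Bool} {r a b : ℕ → ℕ} (hr : IsPartition r)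
    (ha : IsPartition a) (hb : IsPartition b) (hra : BoxStep r a) (hrb : BoxStep r b)
    (hx : x = true → a = r ∧ b = r) : ∃ c, IsPartition c ∧ LocalRule x r a b c := by
  cases x with
  | true =>
    obtain ⟨rfl, rfl⟩ := hx rfl
    obtain ⟨j, h1, h2⟩ := ha.exists_add ha.2
    exact ⟨_, h2, .point h1⟩
  | false =>
    rcases id hra with rfl | ⟨i, rfl⟩
    · exact ⟨b, hb, .left hrb⟩
    rcases id hrb with rfl | ⟨j, rfl⟩
    · exact ⟨_, ha, .right hra⟩
    by_cases hij : i = j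
    · subst hij
      obtain ⟨j, h1, h2⟩ := ha.exists_add ⟨i, rfl⟩
      exact ⟨_, h2, .bump (by simpa using h1)⟩
    · refine ⟨_, ?_, .diag hij⟩
      rw [← add_single_sup hij]
      refine ⟨ha.1.sup hb.1, ?_⟩
      obtain ⟨N, hN⟩ := ha.2
      obtain ⟨M, hM⟩ := hb.2
      refine ⟨max N M, ?_⟩
      have h1 := ha.1 (le_max_left N M)
      have h2 := hb.1 (le_max_right N M)
      rw [Pi.sup_apply]
      omega

theorem exists_localRule_backward {a b c : ℕ → ℕ} (ha : IsPartition a) (hb : IsPartition b)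
    (hc : IsPartition c) (hac : BoxStep a c) (hbc : BoxStep b c) :
    ∃ x r, IsPartition r ∧ LocalRule x r a b c := by
  rcases id hac with rfl | ⟨j, rfl⟩
  · exact ⟨false, b, hb, .right hbc⟩
  rcases id hbc with rfl | ⟨i, h⟩
  · exact ⟨false, a, ha, .left hac⟩
  by_cases hij : j = i
  · subst hij
    obtain rfl := add_right_cancel h
    rcases Nat.eq_zero_or_pos (a j) with h0 | h0
    · exact ⟨true, a, ha, .point h0⟩
    · obtain ⟨i, r, h1, h2, rfl⟩ := ha.exists_sub h0
      exact ⟨false, r, h2, .bump (by simpa using h1.symm)⟩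
  · have h1 : ∀ t, a t + (Pi.single j 1 : ℕ → ℕ) t = b t + (Pi.single i 1 : ℕ → ℕ) t :=
      fun t => congrFun h t
    have ea : a = a ⊓ b + Pi.single i 1 := by
      ext t
      have := h1 t
      simp only [Pi.inf_apply, Pi.add_apply, Pi.single_apply] at this ⊢
      split_ifs at this ⊢ <;> omega
    have eb : b = a ⊓ b + Pi.single j 1 := by
      ext t
      have := h1 t
      simp only [Pi.inf_apply, Pi.add_apply, Pi.single_apply] at this ⊢
      split_ifs at this ⊢ <;> omega
    refine ⟨false, a ⊓ b, ha.of_le (ha.1.inf hb.1) inf_le_left, ?_⟩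
    have := LocalRule.diag (r := a ⊓ b) (Ne.symm hij)
    rwa [← ea, ← eb] at this

/-- The number of nonzero parts obeys the recursion of longest increasing subsequences. -/
theorem LocalRule.pos_iff {x : Bool} {r a b c : ℕ → ℕ} (h : LocalRule x r a b c)
    (hr : Antitone r) (hc : Antitone c) (m : ℕ) :
    0 < c m ↔ 0 < a m ∨ 0 < b m ∨ (x = true ∧ ∀ l, m = l + 1 → 0 < r l) := by
  have hac := h.step_right.le m
  have hbc := h.step_top.le m
  by_cases hab : a = b
  · subst hab
    rcases h.of_eq rfl with ⟨h0, h1, h2⟩ | ⟨h0, i, j, h1, h2, h3⟩ | ⟨h0, h1, j, h2, h3⟩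
    · simp [h0, h2]
    · have e1 := congrFun h1 i
      have e2 := congrFun h2 m
      simp only [Pi.add_apply, Pi.single_apply] at e1 e2
      by_cases hm : m = j
      · subst hm
        simp only [if_true] at e1 e2
        have : 0 < c m ↔ 0 < a m := by omega
        simp [h0, this]
      · simp [hm] at e2
        simp [h0, e2]
    · subst h0 h1 h2
      by_cases hm : m = j
      · subst hm
        have : ∀ l, m = l + 1 → 0 < r l := by
          rintro l rfl
          have := hc (Nat.le_add_right l 1)
          simp at this
          omega
        simpa using .inr this
      · have e : (r + Pi.single j 1 : ℕ → ℕ) m = r m := by simp [hm]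
        rw [e]
        refine ⟨.inl, ?_⟩
        rintro (h | h | ⟨-, h⟩)
        · exact h
        · exact h
        · by_contra h5
          rcases lt_or_gt_of_ne hm with hlt | hlt
          · have := hc hlt.le
            rw [e] at this
            simp at this
            omega
          · have h6 := h (m - 1) (by omega)
            have h7 := hr (show j ≤ m - 1 by omega)
            omega
  · obtain ⟨h0, h1, h2⟩ := h.of_ne hab
    have := congrFun h2 m
    rw [Pi.sup_apply] at this
    simp [h0]
    omega

/-- Two-dimensional recursion: a function on the quarter plane is determined by its values on the
axes and by a rule for unit squares. -/
theorem exists_grid {S : Type*} (f g : ℕ → S) (h : g 0 = f 0) (F : ℕ → ℕ → S → S → S → S) :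
    ∃ L : ℕ → ℕ → S, (∀ j, L 0 j = f j) ∧ (∀ i, L i 0 = g i) ∧
      ∀ i j, L (i + 1) (j + 1) = F i j (L i j) (L (i + 1) j) (L i (j + 1)) := by
  refine ⟨fun i => Nat.rec f (fun i row j =>
    Nat.rec (g (i + 1)) (fun j prev => F i j (row j) prev (row (j + 1))) j) i,
    fun j => rfl, fun i => ?_, fun i j => rfl⟩
  cases i with
  | zero => exact h.symm
  | succ i => rfl

theorem isPartition_zero : IsPartition 0 := ⟨fun _ _ _ => le_rfl, 0, rfl⟩

/-- A growth diagram on an `n × n` board whose points are the squares marked by `X`. -/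
structure IsGrowth (n : ℕ) (X : ℕ → ℕ → Bool) (L : ℕ → ℕ → ℕ → ℕ) : Prop where
  part : ∀ i ≤ n, ∀ j ≤ n, IsPartition (L i j)
  left : ∀ j ≤ n, L 0 j = 0
  bot : ∀ i ≤ n, L i 0 = 0
  rule : ∀ i < n, ∀ j < n,
    LocalRule (X i j) (L i j) (L (i + 1) j) (L i (j + 1)) (L (i + 1) (j + 1))

theorem exists_isGrowth (n : ℕ) {X : ℕ → ℕ → Bool}
    (hrow : ∀ i j j', X i j = true → X i j' = true → j = j')
    (hcol : ∀ i i' j, X i j = true → X i' j = true → i = i') : ∃ L, IsGrowth n X L := by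
  classical
  let F : ℕ → ℕ → (ℕ → ℕ) → (ℕ → ℕ) → (ℕ → ℕ) → (ℕ → ℕ) := fun i j r a b =>
    if h : ∃ c, IsPartition c ∧ LocalRule (X i j) r a b c then h.choose else 0
  have hF : ∀ i j r a b, (∃ c, IsPartition c ∧ LocalRule (X i j) r a b c) →
      IsPartition (F i j r a b) ∧ LocalRule (X i j) r a b (F i j r a b) := by
    intro i j r a b h
    simp only [F, dif_pos h]
    exact h.choose_spec
  obtain ⟨L, hL0, hL1, hL⟩ := exists_grid (fun _ => (0 : ℕ → ℕ)) (fun _ => 0) rfl F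
  have main : ∀ i j, IsPartition (L i j) ∧ BoxStep (L i j) (L i (j + 1)) ∧
      (L i (j + 1) ≠ L i j ↔ ∃ t < i, X t j = true) ∧
      (0 < i → LocalRule (X (i - 1) j) (L (i - 1) j) (L i j) (L (i - 1) (j + 1)) (L i (j + 1))) := by
    intro i
    induction i with
    | zero => intro j; simp [hL0, isPartition_zero, BoxStep]
    | succ i ih =>
      have hsq : ∀ j, IsPartition (L (i + 1) j) ∧ BoxStep (L i j) (L (i + 1) j) ∧
          (L (i + 1) j ≠ L i j ↔ ∃ t < j, X i t = true) →
          IsPartition (L (i + 1) (j + 1)) ∧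
          LocalRule (X i j) (L i j) (L (i + 1) j) (L i (j + 1)) (L (i + 1) (j + 1)) := by
        rintro j ⟨h1, h2, h3⟩
        rw [hL]
        refine hF _ _ _ _ _ (exists_localRule_forward (ih j).1 h1 (ih (j + 1)).1 h2 (ih j).2.1 ?_)
        intro hx
        constructor
        · by_contra hne
          obtain ⟨t, ht, hX⟩ := h3.1 hne
          exact ht.ne (hrow _ _ _ hX hx)
        · by_contra hne
          obtain ⟨t, ht, hX⟩ := (ih j).2.2.1.1 hne
          exact ht.ne (hcol _ _ _ hX hx)
      have hcolumn : ∀ j, IsPartition (L (i + 1) j) ∧ BoxStep (L i j) (L (i + 1) j) ∧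
          (L (i + 1) j ≠ L i j ↔ ∃ t < j, X i t = true) := by
        intro j
        induction j with
        | zero => simp [hL1, isPartition_zero, BoxStep]
        | succ j ihj =>
          obtain ⟨h1, h2⟩ := hsq j ihj
          refine ⟨h1, h2.step_top, ?_⟩
          have h3 := ihj.2.2
          rw [Ne, h2.eq_top_iff]
          simp only [Nat.lt_succ_iff_lt_or_eq, or_and_right, exists_or, exists_eq_left, ← h3]
          cases X i j <;> simp
      intro j
      obtain ⟨h1, h2⟩ := hsq j (hcolumn j)
      refine ⟨(hcolumn j).1, h2.step_right, ?_, fun _ => h2⟩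
      have h3 := (ih j).2.2.1
      rw [Ne, h2.eq_right_iff]
      simp only [Nat.lt_succ_iff_lt_or_eq, or_and_right, exists_or, exists_eq_left, ← h3]
      cases X i j <;> simp
  exact ⟨L, fun i _ j _ => (main i j).1, fun j _ => hL0 j, fun i _ => hL1 i,
    fun i _ j _ => (main (i + 1) j).2.2.2 i.succ_pos⟩

theorem exists_isGrowth_of_boundary {n : ℕ} {p q : ℕ → ℕ → ℕ} (hp : ∀ j, IsPartition (p j))
    (hq : ∀ i, IsPartition (q i)) (hp0 : p 0 = 0) (hq0 : q 0 = 0) (hpq : p n = q n)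
    (hps : ∀ j < n, BoxStep (p j) (p (j + 1))) (hqs : ∀ i < n, BoxStep (q i) (q (i + 1))) :
    ∃ X L, IsGrowth n X L ∧ (∀ j ≤ n, L n j = p j) ∧ ∀ i ≤ n, L i n = q i := by
  classical
  let F : ℕ → ℕ → (ℕ → ℕ) → (ℕ → ℕ) → (ℕ → ℕ) → (ℕ → ℕ) := fun _ _ c b a =>
    if h : ∃ r, IsPartition r ∧ ∃ x, LocalRule x r a b c then h.choose else 0
  have hF : ∀ i j c b a, (∃ x r, IsPartition r ∧ LocalRule x r a b c) →
      IsPartition (F i j c b a) ∧ ∃ x, LocalRule x (F i j c b a) a b c := by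
    rintro i j c b a ⟨x, r, h1, h2⟩
    have h : ∃ r, IsPartition r ∧ ∃ x, LocalRule x r a b c := ⟨r, h1, x, h2⟩
    simp only [F, dif_pos h]
    exact h.choose_spec
  obtain ⟨M, hM0, hM1, hM⟩ := exists_grid (fun j => p (n - j)) (fun i => q (n - i)) hpq.symm F
  have stepsub : ∀ f : ℕ → ℕ → ℕ, (∀ j < n, BoxStep (f j) (f (j + 1))) →
      ∀ j, BoxStep (f (n - (j + 1))) (f (n - j)) := by
    intro f hf j
    rcases lt_or_ge j n with hj | hj
    · have := hf (n - (j + 1)) (by omega)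
      rwa [show n - (j + 1) + 1 = n - j by omega] at this
    · rw [show n - (j + 1) = n - j by omega]
      exact .inl rfl
  have main : ∀ i j, IsPartition (M i j) ∧ BoxStep (M i (j + 1)) (M i j) ∧
      (0 < i → ∃ x, LocalRule x (M i (j + 1)) (M (i - 1) (j + 1)) (M i j) (M (i - 1) j)) := by
    intro i
    induction i with
    | zero => intro j; simpa [hM0, hp] using stepsub p hps j
    | succ i ih =>
      have hsq : ∀ j, IsPartition (M (i + 1) j) ∧ BoxStep (M (i + 1) j) (M i j) →
          IsPartition (M (i + 1) (j + 1)) ∧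
          ∃ x, LocalRule x (M (i + 1) (j + 1)) (M i (j + 1)) (M (i + 1) j) (M i j) := by
        rintro j ⟨h1, h2⟩
        rw [hM]
        exact hF i j _ _ _ (exists_localRule_backward (ih (j + 1)).1 h1 (ih j).1 (ih j).2.1 h2)
      have hcolumn : ∀ j, IsPartition (M (i + 1) j) ∧ BoxStep (M (i + 1) j) (M i j) := by
        intro j
        induction j with
        | zero => simpa [hM1, hq] using stepsub q hqs i
        | succ j ihj =>
          obtain ⟨h1, x, h2⟩ := hsq j ihj
          exact ⟨h1, h2.step_bot⟩
      intro j
      obtain ⟨h1, x, h2⟩ := hsq j (hcolumn j)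
      exact ⟨(hcolumn j).1, h2.step_left, fun _ => ⟨x, h2⟩⟩
  have hle : ∀ i j, M (i + 1) j ≤ M i j := by
    intro i j
    obtain ⟨x, h⟩ := (main (i + 1) j).2.2 i.succ_pos
    exact h.step_top.le
  have hrule : ∀ i < n, ∀ j < n, ∃ x, LocalRule x (M (n - i) (n - j)) (M (n - (i + 1)) (n - j))
      (M (n - i) (n - (j + 1))) (M (n - (i + 1)) (n - (j + 1))) := by
    intro i hi j hj
    have := (main (n - i) (n - (j + 1))).2.2 (by omega)
    rwa [show n - (j + 1) + 1 = n - j by omega, show n - i - 1 = n - (i + 1) by omega] at this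
  choose! X hX using hrule
  refine ⟨X, fun i j => M (n - i) (n - j), ⟨fun i _ j _ => (main _ _).1, fun j hj => ?_,
    fun i hi => ?_, hX⟩, fun j hj => ?_, fun i hi => ?_⟩
  · have h0 : M n 0 = 0 := by rw [hM1, Nat.sub_self, hq0]
    have hmono : ∀ t, M n t ≤ M n 0 := by
      intro t
      induction t with
      | zero => exact le_rfl
      | succ t ih => exact ((main n t).2.1.le).trans ih
    exact le_antisymm ((hmono _).trans h0.le) (fun _ => Nat.zero_le _)
  · have h0 : M 0 n = 0 := by rw [hM0, Nat.sub_self, hp0]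
    have hmono : ∀ t, M t n ≤ M 0 n := by
      intro t
      induction t with
      | zero => exact le_rfl
      | succ t ih => exact (hle t n).trans ih
    exact le_antisymm ((hmono _).trans h0.le) (fun _ => Nat.zero_le _)
  · simp [hM0, Nat.sub_sub_self hj]
  · simp [hM1, Nat.sub_sub_self hi]

namespace IsGrowth

variable {n : ℕ} {X X' : ℕ → ℕ → Bool} {L L' : ℕ → ℕ → ℕ → ℕ}

theorem transpose (h : IsGrowth n X L) : IsGrowth n (fun i j => X j i) (fun i j => L j i) :=
  ⟨fun i hi j hj => h.part j hj i hi, h.bot, h.left, fun i hi j hj => (h.rule j hj i hi).symm⟩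

theorem unique_forward (h : IsGrowth n X L) (h' : IsGrowth n X L') :
    ∀ i ≤ n, ∀ j ≤ n, L i j = L' i j := by
  intro i
  induction i with
  | zero => intro _ j hj; rw [h.left j hj, h'.left j hj]
  | succ i ih =>
    intro hi j
    induction j with
    | zero => intro _; rw [h.bot _ hi, h'.bot _ hi]
    | succ j ihj =>
      intro hj
      have h1 := h.rule i hi j hj
      have h2 := h'.rule i hi j hj
      rw [ih (by omega) j (by omega), ih (by omega) (j + 1) hj, ihj (by omega)] at h1
      exact h1.unique_forward (h.part _ hi _ hj).1 (h'.part _ hi _ hj).1 h2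

theorem unique_backward (h : IsGrowth n X L) (h' : IsGrowth n X' L')
    (htop : ∀ i ≤ n, L i n = L' i n) (hright : ∀ j ≤ n, L n j = L' n j) :
    ∀ i < n, ∀ j < n, X i j = X' i j := by
  have main : ∀ d ≤ n, ∀ e ≤ n, L (n - d) (n - e) = L' (n - d) (n - e) := by
    intro d
    induction d with
    | zero => intro _ e he; exact hright _ (by omega)
    | succ d ih =>
      intro hd e
      induction e with
      | zero => intro _; exact htop _ (by omega)
      | succ e ihe =>
        intro he
        have h1 := h.rule (n - (d + 1)) (by omega) (n - (e + 1)) (by omega)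
        have h2 := h'.rule (n - (d + 1)) (by omega) (n - (e + 1)) (by omega)
        rw [show n - (d + 1) + 1 = n - d by omega, show n - (e + 1) + 1 = n - e by omega] at h1 h2
        rw [ih (by omega) e (by omega), ih (by omega) (e + 1) he, ihe (by omega)] at h1
        exact (h1.unique_backward (h.part _ (by omega) _ (by omega)).1
          (h'.part _ (by omega) _ (by omega)).1 h2).2
  have main' : ∀ i ≤ n, ∀ j ≤ n, L i j = L' i j := by
    intro i hi j hj
    have := main (n - i) (by omega) (n - j) (by omega)
    rwa [Nat.sub_sub_self hi, Nat.sub_sub_self hj] at this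
  intro i hi j hj
  have h1 := h.rule i hi j hj
  have h2 := h'.rule i hi j hj
  rw [main' (i + 1) hi j hj.le, main' i hi.le (j + 1) hj, main' (i + 1) hi (j + 1) hj] at h1
  exact (h1.unique_backward (h.part _ hi.le _ hj.le).1 (h'.part _ hi.le _ hj.le).1 h2).1

theorem ne_iff (h : IsGrowth n X L) {i : ℕ} (hi : i < n) :
    ∀ j ≤ n, L (i + 1) j ≠ L i j ↔ ∃ t < j, X i t = true := by
  intro j
  induction j with
  | zero => intro _; simp [h.bot _ hi, h.bot _ hi.le]
  | succ j ih =>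
    intro hj
    have h3 := ih (by omega)
    rw [Ne, (h.rule i hi j hj).eq_top_iff]
    simp only [Nat.lt_succ_iff_lt_or_eq, or_and_right, exists_or, exists_eq_left, ← h3]
    cases X i j <;> simp

theorem existsUnique_point (h : IsGrowth n X L) {i : ℕ} (hi : i < n) (hne : L (i + 1) n ≠ L i n) :
    ∃ j < n, X i j = true ∧ ∀ t < n, X i t = true → t = j := by
  have key : ∀ s < n, ∀ t < n, X i s = true → X i t = true → ¬ s < t := by
    intro s _ t ht hs hX hst
    refine (h.ne_iff hi t ht.le).2 ⟨s, hst, hs⟩ ?_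
    have := h.rule i hi t ht
    rw [hX] at this
    exact this.eq_of_point.1
  obtain ⟨j, hj, hX⟩ := (h.ne_iff hi n le_rfl).1 hne
  refine ⟨j, hj, hX, fun t ht hX' => ?_⟩
  have h1 := key t ht j hj hX' hX
  have h2 := key j hj t ht hX hX'
  omega

theorem boxStep_right (h : IsGrowth n X L) {i j : ℕ} (hi : i ≤ n) (hj : j < n) :
    BoxStep (L i j) (L i (j + 1)) := by
  cases i with
  | zero => exact .inl (by rw [h.left _ hj, h.left _ hj.le])
  | succ i => exact (h.rule i hi j hj).step_right

end IsGrowth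

/-- There is an increasing sequence of `m + 1` points marked by `X` in `[0, i) × [0, j)`. -/
def HasIncreasing (X : ℕ → ℕ → Bool) : ℕ → ℕ → ℕ → Prop
  | 0, i, j => ∃ a < i, ∃ b < j, X a b = true
  | m + 1, i, j => ∃ a < i, ∃ b < j, X a b = true ∧ HasIncreasing X m a b

theorem hasIncreasing_iff {X : ℕ → ℕ → Bool} {m i j : ℕ} : HasIncreasing X m i j ↔
    ∃ a < i, ∃ b < j, X a b = true ∧ ∀ l, m = l + 1 → HasIncreasing X l a b := by
  cases m <;> simp [HasIncreasing]

theorem hasIncreasing_succ {X : ℕ → ℕ → Bool} {m i j : ℕ} :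
    HasIncreasing X m (i + 1) (j + 1) ↔ HasIncreasing X m (i + 1) j ∨ HasIncreasing X m i (j + 1) ∨
      (X i j = true ∧ ∀ l, m = l + 1 → HasIncreasing X l i j) := by
  simp only [hasIncreasing_iff (m := m)]
  constructor
  · rintro ⟨a, ha, b, hb, h⟩
    rcases Nat.lt_succ_iff_lt_or_eq.1 ha with ha' | rfl
    · exact .inr (.inl ⟨a, ha', b, hb, h⟩)
    rcases Nat.lt_succ_iff_lt_or_eq.1 hb with hb' | rfl
    · exact .inl ⟨a, ha, b, hb', h⟩
    · exact .inr (.inr h)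
  · rintro (⟨a, ha, b, hb, h⟩ | ⟨a, ha, b, hb, h⟩ | h)
    · exact ⟨a, ha, b, by omega, h⟩
    · exact ⟨a, by omega, b, hb, h⟩
    · exact ⟨i, i.lt_succ_self, j, j.lt_succ_self, h⟩

theorem IsGrowth.pos_iff {n : ℕ} {X : ℕ → ℕ → Bool} {L : ℕ → ℕ → ℕ → ℕ} (h : IsGrowth n X L) :
    ∀ i ≤ n, ∀ j ≤ n, ∀ m, 0 < L i j m ↔ HasIncreasing X m i j := by
  intro i
  induction i with
  | zero => intro _ j hj m; rw [h.left j hj, hasIncreasing_iff]; simp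
  | succ i ih =>
    intro hi j
    induction j with
    | zero => intro _ m; rw [h.bot _ hi, hasIncreasing_iff]; simp
    | succ j ihj =>
      intro hj m
      rw [(h.rule i hi j hj).pos_iff (h.part _ (by omega) _ (by omega)).1 (h.part _ hi _ hj).1,
        hasIncreasing_succ, ihj (by omega), ih (by omega) _ hj]
      simp only [ih (by omega : i ≤ n) j (by omega)]

section LatticeWords

variable {n k : ℕ}

/-- `content w j c` is the number of letters `c` among the first `j` letters of the word `w`. -/
def content (w : Fin n → Fin k) (j : ℕ) : ℕ → ℕ :=
  ∑ t : Fin n, if (t : ℕ) < j then Pi.single (w t : ℕ) 1 else 0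

/-- Lattice words, i.e. words each of whose prefixes has a partition as its content. -/
def IsLatticeWord (w : Fin n → Fin k) : Prop := ∀ j, Antitone (content w j)

theorem content_zero (w : Fin n → Fin k) : content w 0 = 0 := by simp [content]

theorem content_succ (w : Fin n → Fin k) (t : Fin n) :
    content w (t + 1) = content w t + Pi.single (w t : ℕ) 1 := by
  have h : (Pi.single (w t : ℕ) 1 : ℕ → ℕ) =
      ∑ s : Fin n, if s = t then Pi.single (w s : ℕ) 1 else 0 := by simp
  rw [h, content, content, ← Finset.sum_add_distrib]
  refine Finset.sum_congr rfl fun s _ => ?_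
  rcases lt_trichotomy s t with hst | rfl | hst
  · have h1 : (s : ℕ) < t := hst
    simp [h1, hst.ne, h1.trans (Nat.lt_succ_self _)]
  · simp
  · have h1 : (t : ℕ) < s := hst
    simp [hst.ne', show ¬ (s : ℕ) < t + 1 by omega, show ¬ (s : ℕ) < t by omega]

theorem content_of_le (w : Fin n → Fin k) {j : ℕ} (hj : n ≤ j) : content w j = content w n :=
  Finset.sum_congr rfl fun s _ => by simp [s.2, s.2.trans_le hj]

theorem content_apply_of_le (w : Fin n → Fin k) (j : ℕ) {c : ℕ} (hc : k ≤ c) :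
    content w j c = 0 := by
  rw [content, Finset.sum_apply]
  refine Finset.sum_eq_zero fun s _ => ?_
  have h := (w s).2
  split_ifs
  · simp [show c ≠ w s by omega]
  · rfl

theorem IsLatticeWord.isPartition {w : Fin n → Fin k} (hw : IsLatticeWord w) (j : ℕ) :
    IsPartition (content w j) := ⟨hw j, k, content_apply_of_le w j le_rfl⟩

theorem content_boxStep (w : Fin n → Fin k) {j : ℕ} (hj : j < n) :
    BoxStep (content w j) (content w (j + 1)) := .inr ⟨_, content_succ w ⟨j, hj⟩⟩

theorem eq_of_content_eq {w w' : Fin n → Fin k} (h : ∀ j ≤ n, content w j = content w' j) :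
    w = w' := by
  ext t
  have h1 := content_succ w t
  rw [h _ t.2, h _ t.2.le, content_succ] at h1
  exact (single_one_inj.1 (add_left_cancel h1)).symm

theorem exists_word {p : ℕ → ℕ → ℕ} (h0 : p 0 = 0) (hp : ∀ j ≤ n, IsPartition (p j))
    (hs : ∀ j < n, BoxStep (p j) (p (j + 1))) (hne : ∀ j < n, p (j + 1) ≠ p j) (hk : p n k = 0) :
    ∃ w : Fin n → Fin k, IsLatticeWord w ∧ ∀ j ≤ n, content w j = p j := by
  have hle : ∀ d ≤ n, p (n - d) k = 0 := by
    intro d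
    induction d with
    | zero => intro _; exact hk
    | succ d ih =>
      intro hd
      have h1 := (hs (n - (d + 1)) (by omega)).le k
      rw [show n - (d + 1) + 1 = n - d by omega, ih (by omega)] at h1
      exact Nat.le_zero.1 h1
  have hex : ∀ t : Fin n, ∃ i : Fin k, p (t + 1) = p t + Pi.single (i : ℕ) 1 := by
    intro t
    obtain ⟨i, hi⟩ := (hs t t.2).resolve_left (hne t t.2)
    refine ⟨⟨i, ?_⟩, hi⟩
    by_contra hik
    have h1 := hle (n - (t + 1)) (by omega)
    rw [Nat.sub_sub_self t.2] at h1
    have h2 : p ((t : ℕ) + 1) i ≤ p ((t : ℕ) + 1) k := (hp _ t.2).1 (not_lt.1 hik)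
    have h3 : p ((t : ℕ) + 1) i = p t i + 1 := by simp [hi]
    have h4 : p ((t : ℕ) + 1) k ≤ 0 := h1.le
    omega
  choose w hw using hex
  have hc : ∀ j ≤ n, content w j = p j := by
    intro j
    induction j with
    | zero => intro _; rw [content_zero, h0]
    | succ j ih =>
      intro hj
      rw [hw ⟨j, hj⟩, ← ih (by omega)]
      exact content_succ w ⟨j, hj⟩
  refine ⟨w, fun j => ?_, hc⟩
  rcases le_total j n with hj | hj
  · rw [hc j hj]
    exact (hp j hj).1
  · rw [content_of_le w hj, hc n le_rfl]
    exact (hp n le_rfl).1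

end LatticeWords

/-- The board of a permutation. -/
def permBoard {n : ℕ} (σ : Equiv.Perm (Fin n)) (i j : ℕ) : Bool :=
  decide (∃ h : i < n, (σ ⟨i, h⟩ : ℕ) = j)

theorem permBoard_iff {n : ℕ} {σ : Equiv.Perm (Fin n)} {i j : ℕ} :
    permBoard σ i j = true ↔ ∃ h : i < n, (σ ⟨i, h⟩ : ℕ) = j := by simp [permBoard]

theorem exists_isGrowth_permBoard {n : ℕ} (σ : Equiv.Perm (Fin n)) :
    ∃ L, IsGrowth n (permBoard σ) L := by
  refine exists_isGrowth n ?_ ?_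
  · intro i j j' h h'
    obtain ⟨hi, rfl⟩ := permBoard_iff.1 h
    obtain ⟨_, rfl⟩ := permBoard_iff.1 h'
    rfl
  · intro i i' j h h'
    obtain ⟨hi, rfl⟩ := permBoard_iff.1 h
    obtain ⟨hi', h⟩ := permBoard_iff.1 h'
    have := σ.injective (Fin.ext h)
    simpa using this.symm

theorem IsGrowth.exists_perm {n : ℕ} {X : ℕ → ℕ → Bool} {L : ℕ → ℕ → ℕ → ℕ}
    (h : IsGrowth n X L) (h1 : ∀ i < n, L (i + 1) n ≠ L i n) (h2 : ∀ j < n, L n (j + 1) ≠ L n j) :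
    ∃ σ : Equiv.Perm (Fin n), IsGrowth n (permBoard σ) L := by
  have key1 := fun i : Fin n => h.existsUnique_point i.2 (h1 i i.2)
  have key2 := fun j : Fin n => h.transpose.existsUnique_point j.2 (h2 j j.2)
  choose f hf hX hu using key1
  have hinj : Function.Injective fun i => (⟨f i, hf i⟩ : Fin n) := by
    intro i i' hii
    have hii : f i = f i' := by simpa using hii
    obtain ⟨t, -, -, ht⟩ := key2 ⟨f i, hf i⟩
    have e1 := ht i i.2 (hX i)
    have e2 := ht i' i'.2 (by simpa [hii] using hX i')
    exact Fin.ext (e1.trans e2.symm)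
  refine ⟨Equiv.ofBijective _ (Finite.injective_iff_bijective.1 hinj), h.part, h.left, h.bot, ?_⟩
  intro i hi j hj
  have : permBoard (Equiv.ofBijective _ (Finite.injective_iff_bijective.1 hinj)) i j = X i j := by
    rw [Bool.eq_iff_iff, permBoard_iff]
    constructor
    · rintro ⟨hi, rfl⟩
      exact hX ⟨i, hi⟩
    · intro hx
      exact ⟨hi, (hu ⟨i, hi⟩ j hj hx).symm⟩
  rw [this]
  exact h.rule i hi j hj

/-- The Robinson–Schensted correspondence together with Schensted's theorem: permutations without
increasing subsequences of length `k + 1` are equinumerous with pairs of lattice words in `k`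
letters with the same content. -/
theorem card_not_hasIncreasing (n k : ℕ) :
    Nat.card {σ : Equiv.Perm (Fin n) // ¬ HasIncreasing (permBoard σ) k n n} =
      Nat.card {w : (Fin n → Fin k) × (Fin n → Fin k) //
        IsLatticeWord w.1 ∧ IsLatticeWord w.2 ∧ content w.1 n = content w.2 n} := by
  let R : Equiv.Perm (Fin n) → (Fin n → Fin k) × (Fin n → Fin k) → Prop := fun σ w =>
    ∃ L, IsGrowth n (permBoard σ) L ∧ (∀ j ≤ n, L n j = content w.1 j) ∧
      ∀ i ≤ n, L i n = content w.2 i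
  have h1 : ∀ σ : {σ : Equiv.Perm (Fin n) // ¬ HasIncreasing (permBoard σ) k n n},
      ∃ w : {w : (Fin n → Fin k) × (Fin n → Fin k) //
        IsLatticeWord w.1 ∧ IsLatticeWord w.2 ∧ content w.1 n = content w.2 n}, R σ w := by
    rintro ⟨σ, hσ⟩
    obtain ⟨L, hL⟩ := exists_isGrowth_permBoard σ
    have hk : L n n k = 0 := by
      have := hL.pos_iff n le_rfl n le_rfl k
      by_contra h0
      exact hσ (this.1 (Nat.pos_of_ne_zero h0))
    obtain ⟨w, hw, hw'⟩ := exists_word (k := k) (p := fun j => L n j) (hL.bot n le_rfl)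
      (hL.part n le_rfl) (fun j hj => hL.boxStep_right le_rfl hj) (fun j hj => by
        refine (hL.transpose.ne_iff hj n le_rfl).2 ⟨σ.symm ⟨j, hj⟩, Fin.is_lt _, ?_⟩
        simp [permBoard_iff]) hk
    obtain ⟨v, hv, hv'⟩ := exists_word (k := k) (p := fun i => L i n) (hL.left n le_rfl)
      (fun i hi => hL.part i hi n le_rfl)
      (fun i hi => hL.transpose.boxStep_right le_rfl hi) (fun i hi => by
        refine (hL.ne_iff hi n le_rfl).2 ⟨σ ⟨i, hi⟩, Fin.is_lt _, ?_⟩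
        simp [permBoard_iff, hi]) hk
    exact ⟨⟨(w, v), hw, hv, (hw' n le_rfl).trans (hv' n le_rfl).symm⟩, L, hL,
      fun j hj => (hw' j hj).symm, fun i hi => (hv' i hi).symm⟩
  choose F hF using h1
  refine Nat.card_congr (Equiv.ofBijective F ⟨?_, ?_⟩)
  · intro σ σ' hσ
    obtain ⟨L, hL, ha, hb⟩ := hF σ
    obtain ⟨L', hL', ha', hb'⟩ := hF σ'
    rw [← hσ] at ha' hb'
    have := hL.unique_backward hL' (fun i hi => (hb i hi).trans (hb' i hi).symm)
      (fun j hj => (ha j hj).trans (ha' j hj).symm)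
    ext i
    have h2 : permBoard σ'.1 i (σ.1 i) = true := by
      rw [← this i i.2 _ (Fin.is_lt _), permBoard_iff]
      exact ⟨i.2, rfl⟩
    obtain ⟨_, h3⟩ := permBoard_iff.1 h2
    exact h3.symm
  · rintro ⟨⟨w, v⟩, hw, hv, hwv⟩
    obtain ⟨X, L, hL, ha, hb⟩ := exists_isGrowth_of_boundary hw.isPartition hv.isPartition
      (content_zero w) (content_zero v) hwv (fun j => content_boxStep w) (fun j => content_boxStep v)
    obtain ⟨σ, hσ⟩ := hL.exists_perm
      (fun i hi => by
        rw [hb _ hi, hb _ hi.le, content_succ v ⟨i, hi⟩]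
        exact add_single_ne_self _ _)
      (fun i hi => by
        rw [ha _ hi, ha _ hi.le, content_succ w ⟨i, hi⟩]
        exact add_single_ne_self _ _)
    have hk : ¬ HasIncreasing (permBoard σ) k n n := by
      rw [← hσ.pos_iff n le_rfl n le_rfl, ha n le_rfl, content_apply_of_le w n le_rfl]
      exact lt_irrefl 0
    refine ⟨⟨σ, hk⟩, ?_⟩
    obtain ⟨L', hL', ha', hb'⟩ := hF ⟨σ, hk⟩
    have hu := hσ.unique_forward hL'
    refine Subtype.ext (Prod.ext (eq_of_content_eq fun j hj => ?_) (eq_of_content_eq fun j hj => ?_))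
    · rw [← ha' j hj, ← ha j hj, hu n le_rfl j hj]
    · rw [← hb' j hj, ← hb j hj, hu j hj n le_rfl]

theorem strictMono_snoc {α : Type*} [Preorder α] {m : ℕ} {f : Fin (m + 1) → α} {a : α}
    (hf : StrictMono f) (ha : f (Fin.last m) < a) :
    StrictMono (Fin.snoc f a : Fin (m + 2) → α) := by
  rw [Fin.strictMono_iff_lt_succ]
  intro i
  induction i using Fin.lastCases with
  | last => simpa using ha
  | cast i =>
    rw [← Fin.castSucc_succ, Fin.snoc_castSucc, Fin.snoc_castSucc]
    exact hf i.castSucc_lt_succ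

theorem hasIncreasing_permBoard_iff {n : ℕ} (σ : Equiv.Perm (Fin n)) (m : ℕ) :
    ∀ i j, HasIncreasing (permBoard σ) m i j ↔ ∃ f : Fin (m + 1) → Fin n,
      StrictMono f ∧ StrictMono (σ ∘ f) ∧ (f (Fin.last m) : ℕ) < i ∧
        (σ (f (Fin.last m)) : ℕ) < j := by
  induction m with
  | zero =>
    intro i j
    constructor
    · rintro ⟨a, ha, b, hb, hab⟩
      obtain ⟨h, rfl⟩ := permBoard_iff.1 hab
      have : Subsingleton (Fin (0 + 1)) := inferInstanceAs (Subsingleton (Fin 1))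
      exact ⟨fun _ => ⟨a, h⟩, Subsingleton.strictMono _, Subsingleton.strictMono _, ha, hb⟩
    · rintro ⟨f, -, -, ha, hb⟩
      exact ⟨_, ha, _, hb, permBoard_iff.2 ⟨Fin.is_lt _, rfl⟩⟩
  | succ m ih =>
    intro i j
    constructor
    · rintro ⟨a, ha, b, hb, hab, h'⟩
      obtain ⟨h, rfl⟩ := permBoard_iff.1 hab
      obtain ⟨f, h1, h2, h3, h4⟩ := (ih _ _).1 h'
      refine ⟨Fin.snoc f ⟨a, h⟩, strictMono_snoc h1 h3, ?_, by simpa using ha, by simpa using hb⟩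
      rw [Fin.comp_snoc]
      exact strictMono_snoc h2 h4
    · rintro ⟨f, h1, h2, h3, h4⟩
      refine ⟨_, h3, _, h4, permBoard_iff.2 ⟨Fin.is_lt _, rfl⟩, (ih _ _).2 ⟨f ∘ Fin.castSucc,
        h1.comp Fin.strictMono_castSucc, h2.comp Fin.strictMono_castSucc, ?_, ?_⟩⟩
      · exact h1 (Fin.castSucc_lt_last _)
      · exact h2 (Fin.castSucc_lt_last _)

section Torus

open AddCircle ComplexConjugate

variable {k : ℕ}

theorem integral_fourier (n : ℤ) :
    ∫ x : UnitAddCircle, fourier n x ∂haarAddCircle = if n = 0 then 1 else 0 := by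
  have h := orthonormal_iff_ite.1 (orthonormal_fourier (T := (1 : ℝ))) 0 n
  rw [ContinuousMap.inner_toLp (𝕜 := ℂ) (haarAddCircle (T := (1 : ℝ))) (fourier 0) (fourier n)] at h
  simpa [eq_comm] using h

/-- The uniform probability measure on the torus. -/
noncomputable def torusMeasure (k : ℕ) : Measure (Fin k → UnitAddCircle) :=
  Measure.pi fun _ => haarAddCircle

instance : IsProbabilityMeasure (torusMeasure k) := by
  unfold torusMeasure; infer_instance

theorem integrable_of_continuous_torus {E : Type*} [NormedAddCommGroup E]
    {f : (Fin k → UnitAddCircle) → E} (hf : Continuous f)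
    (μ : Measure (Fin k → UnitAddCircle)) [IsFiniteMeasure μ] : Integrable f μ :=
  hf.integrable_of_hasCompactSupport (HasCompactSupport.of_compactSpace f)

theorem integral_prod_fourier_mul_conj (a b : Fin k → ℤ) :
    ∫ x, (∏ i, fourier (a i) (x i)) * conj (∏ i, fourier (b i) (x i)) ∂torusMeasure k =
      if a = b then 1 else 0 := by
  have h : ∀ x : Fin k → UnitAddCircle,
      (∏ i, fourier (a i) (x i)) * conj (∏ i, fourier (b i) (x i)) =
        ∏ i, fourier (a i - b i) (x i) := by
    intro x
    rw [map_prod, ← Finset.prod_mul_distrib]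
    refine Finset.prod_congr rfl fun i _ => ?_
    rw [sub_eq_add_neg, fourier_add, fourier_neg]
  simp_rw [h]
  rw [torusMeasure, integral_fintype_prod_eq_prod
    (fun i (y : UnitAddCircle) => (fourier (a i - b i) y : ℂ))]
  simp_rw [integral_fourier, sub_eq_zero]
  split_ifs with hab
  · simp [hab]
  · obtain ⟨i, hi⟩ := Function.ne_iff.1 hab
    exact Finset.prod_eq_zero (Finset.mem_univ i) (if_neg hi)

/-- The alternating sum of the characters in the orbit of the weight `m`. -/
noncomputable def altChar (m : Fin k → ℤ) (x : Fin k → UnitAddCircle) : ℂ :=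
  (Matrix.of fun i j => (fourier (m i) (x j) : ℂ)).det

theorem altChar_eq_sum (m : Fin k → ℤ) (x : Fin k → UnitAddCircle) :
    altChar m x = ∑ σ : Equiv.Perm (Fin k),
      ((Equiv.Perm.sign σ : ℤ) : ℂ) * ∏ i, fourier (m (σ i)) (x i) := by
  simp [altChar, Matrix.det_apply']

theorem continuous_altChar (m : Fin k → ℤ) : Continuous (altChar m) := by
  unfold altChar
  refine Continuous.matrix_det (continuous_matrix fun i j => ?_)
  exact (fourier (m i)).continuous.comp (continuous_apply j)

theorem altChar_eq_zero {m : Fin k → ℤ} {i j : Fin k} (hij : i ≠ j) (h : m i = m j) :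
    altChar m = 0 := by
  ext x
  exact Matrix.det_zero_of_row_eq hij (by ext; simp [h])

theorem comp_perm_eq_comp_perm_iff {m m' : Fin k → ℤ} (hm : StrictAnti m) (hm' : StrictAnti m')
    (σ τ : Equiv.Perm (Fin k)) : m ∘ σ = m' ∘ τ ↔ m = m' ∧ σ = τ := by
  refine ⟨fun h => ?_, by rintro ⟨rfl, rfl⟩; rfl⟩
  have h1 : m = m' := by
    have h2 : Set.range (fun i => -m i) = Set.range (fun i => -m' i) := by
      have h3 := congrArg Set.range h
      rw [EquivLike.range_comp, EquivLike.range_comp] at h3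
      have h4 := congrArg (Set.image Neg.neg) h3
      rwa [← Set.range_comp, ← Set.range_comp] at h4
    have h5 := (StrictMono.range_inj (f := fun i => -m i) (g := fun i => -m' i)
      (fun _ _ h => neg_lt_neg (hm h)) (fun _ _ h => neg_lt_neg (hm' h))).1 h2
    ext i
    simpa using congrFun h5 i
  subst h1
  exact ⟨rfl, Equiv.ext fun i => hm.injective (congrFun h i)⟩

theorem integral_altChar_mul_conj {m m' : Fin k → ℤ} (hm : StrictAnti m) (hm' : StrictAnti m') :
    ∫ x, altChar m x * conj (altChar m' x) ∂torusMeasure k =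
      if m = m' then (k.factorial : ℂ) else 0 := by
  have hc : ∀ a : Fin k → ℤ, Continuous fun x : Fin k → UnitAddCircle =>
      (∏ i, fourier (a i) (x i) : ℂ) := fun a =>
    continuous_finsetProd _ fun i _ => (fourier (a i)).continuous.comp (continuous_apply i)
  have h : ∀ x, altChar m x * conj (altChar m' x) =
      ∑ σ : Equiv.Perm (Fin k), ∑ τ : Equiv.Perm (Fin k),
        ((Equiv.Perm.sign σ : ℤ) : ℂ) * ((Equiv.Perm.sign τ : ℤ) : ℂ) *
          ((∏ i, fourier (m (σ i)) (x i)) * conj (∏ i, fourier (m' (τ i)) (x i))) := by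
    intro x
    rw [altChar_eq_sum, altChar_eq_sum, map_sum, Finset.sum_mul_sum]
    refine Finset.sum_congr rfl fun σ _ => Finset.sum_congr rfl fun τ _ => ?_
    rw [map_mul, map_intCast]
    ring
  simp_rw [h]
  rw [integral_finsetSum _ fun σ _ => integrable_of_continuous_torus (by fun_prop) _]
  have h2 : ∀ σ : Equiv.Perm (Fin k), ∫ x, ∑ τ : Equiv.Perm (Fin k),
        ((Equiv.Perm.sign σ : ℤ) : ℂ) * ((Equiv.Perm.sign τ : ℤ) : ℂ) *
          ((∏ i, fourier (m (σ i)) (x i)) * conj (∏ i, fourier (m' (τ i)) (x i)))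
        ∂torusMeasure k = if m = m' then 1 else 0 := by
    intro σ
    rw [integral_finsetSum _ fun τ _ => integrable_of_continuous_torus (by fun_prop) _]
    have h3 : ∀ τ : Equiv.Perm (Fin k), ∫ x,
        ((Equiv.Perm.sign σ : ℤ) : ℂ) * ((Equiv.Perm.sign τ : ℤ) : ℂ) *
          ((∏ i, fourier (m (σ i)) (x i)) * conj (∏ i, fourier (m' (τ i)) (x i)))
        ∂torusMeasure k = if σ = τ then (if m = m' then 1 else 0) else 0 := by
      intro τ
      have h4 := integral_prod_fourier_mul_conj (m ∘ σ) (m' ∘ τ)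
      simp only [Function.comp_apply] at h4
      rw [integral_const_mul, h4, if_congr (comp_perm_eq_comp_perm_iff hm hm' σ τ) rfl rfl]
      by_cases hσ : σ = τ
      · subst hσ
        rw [← Int.cast_mul, Int.units_coe_mul_self]
        simp
      · simp [hσ]
    simp_rw [h3]
    simp
  simp_rw [h2]
  rw [Finset.sum_const, Finset.card_univ, Fintype.card_perm, Fintype.card_fin]
  split_ifs <;> simp

/-- The trace of the diagonal unitary matrix with the given phases. -/
noncomputable def torusTrace (x : Fin k → UnitAddCircle) : ℂ := ∑ i, fourier 1 (x i)

theorem continuous_torusTrace : Continuous (torusTrace (k := k)) :=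
  continuous_finsetSum _ fun i _ => (fourier 1).continuous.comp (continuous_apply i)

theorem torusTrace_mul_altChar (m : Fin k → ℤ) (x : Fin k → UnitAddCircle) :
    torusTrace x * altChar m x = ∑ i, altChar (m + Pi.single i 1) x := by
  simp_rw [altChar_eq_sum]
  rw [Finset.sum_comm, Finset.mul_sum]
  refine Finset.sum_congr rfl fun σ _ => ?_
  rw [← Equiv.sum_comp σ, mul_left_comm, torusTrace, Finset.sum_mul, Finset.mul_sum]
  refine Finset.sum_congr rfl fun i _ => ?_
  congr 1
  rw [← Finset.mul_prod_erase _ _ (Finset.mem_univ i), ← mul_assoc]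
  refine Eq.trans ?_ (Finset.mul_prod_erase _ _ (Finset.mem_univ i))
  congr 1
  · simp [mul_comm]
  · refine Finset.prod_congr rfl fun j hj => ?_
    have h : σ j ≠ σ i := fun h => Finset.ne_of_mem_erase hj (σ.injective h)
    simp [h]

/-- The weight `a` shifted by `-(0, 1, …, k - 1)`. -/
def shiftedWeight (k : ℕ) (a : ℕ → ℕ) (i : Fin k) : ℤ := (a i : ℤ) - i

theorem strictAnti_shiftedWeight {a : ℕ → ℕ} (ha : Antitone a) :
    StrictAnti (shiftedWeight k a) := by
  intro i j hij
  have h1 : a j ≤ a i := ha hij.le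
  have h2 : (i : ℕ) < j := hij
  simp only [shiftedWeight]
  omega

theorem shiftedWeight_add_single (a : ℕ → ℕ) (i : Fin k) :
    shiftedWeight k (a + Pi.single (i : ℕ) 1) = shiftedWeight k a + Pi.single i 1 := by
  ext j
  by_cases h : j = i
  · subst h
    simp [shiftedWeight]
    ring
  · have h' : (j : ℕ) ≠ i := fun h' => h (Fin.ext h')
    simp [shiftedWeight, h, h']

theorem altChar_shiftedWeight_eq_zero {a : ℕ → ℕ} (ha : Antitone a) (i : Fin k)
    (h : ¬ Antitone (a + Pi.single (i : ℕ) 1)) :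
    altChar (shiftedWeight k (a + Pi.single (i : ℕ) 1)) = 0 := by
  obtain ⟨c, hc⟩ : ∃ c, ¬ (a + Pi.single (i : ℕ) 1 : ℕ → ℕ) (c + 1) ≤
      (a + Pi.single (i : ℕ) 1 : ℕ → ℕ) c := by
    by_contra! h'
    exact h (antitone_nat_of_succ_le h')
  have h1 : a (c + 1) ≤ a c := ha (Nat.le_succ c)
  simp only [Pi.add_apply, Pi.single_apply] at hc
  have hci : c + 1 = i := by
    by_contra hne
    rw [if_neg hne] at hc
    omega
  rw [if_pos hci, if_neg (by omega)] at hc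
  have hck : c < k := by omega
  refine altChar_eq_zero (i := i) (j := ⟨c, hck⟩) ?_ ?_
  · intro h
    have := congrArg Fin.val h
    simp at this
    omega
  · simp only [shiftedWeight, Pi.add_apply, Pi.single_apply, if_true]
    rw [if_neg (by omega), ← hci]
    push_cast
    omega

theorem content_snoc_of_le {n : ℕ} (w : Fin n → Fin k) (i : Fin k) {j : ℕ} (hj : j ≤ n) :
    content (Fin.snoc (α := fun _ => Fin k) w i) j = content w j := by
  simp [content, Fin.sum_univ_castSucc, hj.not_gt]

theorem content_snoc {n : ℕ} (w : Fin n → Fin k) (i : Fin k) :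
    content (Fin.snoc (α := fun _ => Fin k) w i) (n + 1) =
      content w n + Pi.single (i : ℕ) 1 := by
  have h := content_succ (Fin.snoc (α := fun _ => Fin k) w i) (Fin.last n)
  simpa [content_snoc_of_le] using h

theorem isLatticeWord_snoc {n : ℕ} (w : Fin n → Fin k) (i : Fin k) :
    IsLatticeWord (Fin.snoc (α := fun _ => Fin k) w i) ↔
      IsLatticeWord w ∧ Antitone (content w n + Pi.single (i : ℕ) 1) := by
  refine ⟨fun h => ⟨fun j => ?_, content_snoc w i ▸ h (n + 1)⟩, fun h j => ?_⟩
  · rcases le_total j n with hj | hj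
    · exact content_snoc_of_le w i hj ▸ h j
    · rw [content_of_le w hj, ← content_snoc_of_le w i le_rfl]
      exact h n
  · rcases Nat.lt_or_ge n j with hj | hj
    · rw [content_of_le _ hj, content_snoc]
      exact h.2
    · rw [content_snoc_of_le w i hj]
      exact h.1 j

open Classical in
theorem torusTrace_pow_mul_altChar (n : ℕ) (x : Fin k → UnitAddCircle) :
    torusTrace x ^ n * altChar (shiftedWeight k 0) x =
      ∑ w : Fin n → Fin k with IsLatticeWord w, altChar (shiftedWeight k (content w n)) x := by
  induction n with
  | zero =>
    rw [Finset.sum_filter, Fintype.sum_unique, content_zero, if_pos]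
    · simp
    · intro j
      rw [content_of_le _ (Nat.zero_le j), content_zero]
      exact antitone_const
  | succ n ih =>
    rw [pow_succ', mul_assoc, ih, Finset.sum_filter, Finset.sum_filter, Finset.mul_sum,
      ← (Fin.snocEquiv fun _ => Fin k).sum_comp, Fintype.sum_prod_type_right]
    refine Finset.sum_congr rfl fun w _ => ?_
    change torusTrace x * _ = ∑ i : Fin k, if IsLatticeWord (Fin.snoc (α := fun _ => Fin k) w i) then
      altChar (shiftedWeight k (content (Fin.snoc (α := fun _ => Fin k) w i) (n + 1))) x else 0
    simp only [isLatticeWord_snoc, content_snoc]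
    by_cases hw : IsLatticeWord w
    · rw [if_pos hw, torusTrace_mul_altChar]
      refine Finset.sum_congr rfl fun i _ => ?_
      rw [← shiftedWeight_add_single]
      by_cases hi : Antitone (content w n + Pi.single (i : ℕ) 1)
      · simp [hw, hi]
      · simp [hi, altChar_shiftedWeight_eq_zero (hw n) i hi]
    · simp [hw]

theorem shiftedWeight_content_inj {n : ℕ} {w w' : Fin n → Fin k} :
    shiftedWeight k (content w n) = shiftedWeight k (content w' n) ↔
      content w n = content w' n := by
  refine ⟨fun h => funext fun c => ?_, fun h => by rw [h]⟩
  rcases Nat.lt_or_ge c k with hc | hc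
  · simpa [shiftedWeight] using congrFun h ⟨c, hc⟩
  · rw [content_apply_of_le w n hc, content_apply_of_le w' n hc]

theorem integral_norm_torusTrace_pow (n : ℕ) :
    ∫ x, (‖torusTrace x‖ ^ 2) ^ n * ‖altChar (shiftedWeight k 0) x‖ ^ 2 ∂torusMeasure k =
      k.factorial * Nat.card {w : (Fin n → Fin k) × (Fin n → Fin k) //
        IsLatticeWord w.1 ∧ IsLatticeWord w.2 ∧ content w.1 n = content w.2 n} := by
  classical
  apply Complex.ofReal_injective
  rw [← integral_complex_ofReal]
  have h : ∀ x : Fin k → UnitAddCircle,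
      (((‖torusTrace x‖ ^ 2) ^ n * ‖altChar (shiftedWeight k 0) x‖ ^ 2 : ℝ) : ℂ) =
      ∑ w : Fin n → Fin k with IsLatticeWord w, ∑ w' : Fin n → Fin k with IsLatticeWord w',
        altChar (shiftedWeight k (content w n)) x *
          conj (altChar (shiftedWeight k (content w' n)) x) := by
    intro x
    rw [← Finset.sum_mul_sum, ← map_sum, ← torusTrace_pow_mul_altChar, Complex.mul_conj']
    simp [mul_pow, ← pow_mul, mul_comm]
  have hc := continuous_altChar (k := k)
  simp_rw [h]
  rw [integral_finsetSum _ fun w _ => integrable_of_continuous_torus (by fun_prop) _]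
  have h2 : ∀ w ∈ Finset.univ.filter fun w : Fin n → Fin k => IsLatticeWord w,
      ∫ x, ∑ w' : Fin n → Fin k with IsLatticeWord w',
        altChar (shiftedWeight k (content w n)) x *
          conj (altChar (shiftedWeight k (content w' n)) x) ∂torusMeasure k =
      ∑ w' : Fin n → Fin k with IsLatticeWord w',
        if content w n = content w' n then (k.factorial : ℂ) else 0 := by
    intro w hw
    rw [integral_finsetSum _ fun w' _ => integrable_of_continuous_torus (by fun_prop) _]
    refine Finset.sum_congr rfl fun w' hw' => ?_
    rw [integral_altChar_mul_conj
      (strictAnti_shiftedWeight ((Finset.mem_filter.1 hw).2 n))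
      (strictAnti_shiftedWeight ((Finset.mem_filter.1 hw').2 n))]
    exact if_congr shiftedWeight_content_inj rfl rfl
  rw [Finset.sum_congr rfl h2, ← Finset.sum_product', ← Finset.sum_filter, Finset.sum_const,
    Nat.card_eq_fintype_card, Fintype.card_subtype, nsmul_eq_mul, mul_comm]
  push_cast
  congr 3
  ext w
  simp [and_assoc]

/-- The law of `|tr U|²` for a Haar distributed unitary `k × k` matrix `U`, by the Weyl integration
formula. -/
noncomputable def traceMeasure (k : ℕ) : Measure ℝ :=
  ((torusMeasure k).withDensity fun x =>
    ENNReal.ofReal (‖altChar (shiftedWeight k 0) x‖ ^ 2 / k.factorial)).map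
      fun x => ‖torusTrace x‖ ^ 2

theorem continuous_norm_torusTrace_sq :
    Continuous fun x : Fin k → UnitAddCircle => ‖torusTrace x‖ ^ 2 :=
  continuous_torusTrace.norm.pow 2

theorem continuous_traceDensity : Continuous fun x : Fin k → UnitAddCircle =>
    ‖altChar (shiftedWeight k 0) x‖ ^ 2 / k.factorial :=
  ((continuous_altChar _).norm.pow 2).div_const _

theorem traceMeasure_Iio : traceMeasure k (Set.Iio 0) = 0 := by
  rw [traceMeasure, Measure.map_apply continuous_norm_torusTrace_sq.measurable measurableSet_Iio]
  have h : (fun x : Fin k → UnitAddCircle => ‖torusTrace x‖ ^ 2) ⁻¹' Set.Iio 0 = ∅ := by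
    ext x
    simp
  rw [h, measure_empty]

theorem integrable_pow_traceMeasure (n : ℕ) : Integrable (fun x => x ^ n) (traceMeasure k) := by
  have := isFiniteMeasure_withDensity_ofReal
    (integrable_of_continuous_torus (continuous_traceDensity (k := k)) (torusMeasure k)).2
  rw [traceMeasure, integrable_map_measure (by fun_prop)
    continuous_norm_torusTrace_sq.measurable.aemeasurable]
  exact integrable_of_continuous_torus (continuous_norm_torusTrace_sq.pow n) _

theorem integral_pow_traceMeasure (n : ℕ) : ∫ x, x ^ n ∂traceMeasure k =
    Nat.card {w : (Fin n → Fin k) × (Fin n → Fin k) //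
      IsLatticeWord w.1 ∧ IsLatticeWord w.2 ∧ content w.1 n = content w.2 n} := by
  rw [traceMeasure, integral_map continuous_norm_torusTrace_sq.measurable.aemeasurable
    (by fun_prop), integral_withDensity_eq_integral_toReal_smul
    continuous_traceDensity.measurable.ennreal_ofReal (by simp)]
  have h : ∀ x : Fin k → UnitAddCircle,
      (ENNReal.ofReal (‖altChar (shiftedWeight k 0) x‖ ^ 2 / k.factorial)).toReal •
        (‖torusTrace x‖ ^ 2) ^ n =
      (k.factorial : ℝ)⁻¹ * ((‖torusTrace x‖ ^ 2) ^ n *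
        ‖altChar (shiftedWeight k 0) x‖ ^ 2) := by
    intro x
    rw [ENNReal.toReal_ofReal (by positivity), smul_eq_mul]
    ring
  simp_rw [h]
  rw [integral_const_mul, integral_norm_torusTrace_pow, inv_mul_cancel_left₀]
  exact_mod_cast k.factorial_ne_zero

end Torus

theorem avoidCount_patt12345 (n : ℕ) : avoidCount patt12345 n =
    Nat.card {σ : Equiv.Perm (Fin n) // ¬ HasIncreasing (permBoard σ) 4 n n} := by
  refine Nat.card_congr (Equiv.subtypeEquivRight fun σ => not_congr ?_)
  rw [hasIncreasing_permBoard_iff]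
  refine exists_congr fun f => and_congr_right fun _ => ?_
  refine ⟨fun h => ⟨fun a b hab => (h a b).2 hab, Fin.is_lt _, Fin.is_lt _⟩, fun h a b => ?_⟩
  exact h.1.lt_iff_lt

/-- The sequence `(s_n(12345))` is a Stieltjes moment sequence: there is a Borel
measure on `[0, ∞)` with finite moments of all orders whose `n`-th moment is
`s_n(12345)`. -/
theorem stmt_17 :
    ∃ ρ : Measure ℝ, ρ (Set.Iio 0) = 0 ∧
      (∀ n : ℕ, Integrable (fun x : ℝ => x ^ n) ρ) ∧
      ∀ n : ℕ, (avoidCount patt12345 n : ℝ) = ∫ x, x ^ n ∂ρ := by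
  refine ⟨traceMeasure 4, traceMeasure_Iio, integrable_pow_traceMeasure, fun n => ?_⟩
  rw [avoidCount_patt12345, card_not_hasIncreasing, integral_pow_traceMeasure]
end

section
/- Let d_{n,h} denote the number of Dyck paths of length 2n whose height is exactly h. Fix a real number y with 0 < y < 1 and set r = −log y, A = 2^{5/3} π^{5/6} / √3, and E = 3(π/2)^{2/3}. Then as n → ∞, ∑_{h=1}^{n} d_{n,h} y^h ∼ ((1−y)/y^2) · r^{1/3} · A · 4^n · exp(−E r^{2/3} n^{1/3}) · n^{−5/6}; that is, the ratio of the left-hand side to the right-hand side tends to 1. -/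
open Filter

/-- `dyckCount n h` is the number of Dyck paths of length `2n` with height
exactly `h`: sequences of `2n` steps `±1` whose partial sums are nonnegative,
whose total sum is `0`, and whose maximal partial sum is exactly `h`. -/
noncomputable def dyckCount (n h : ℕ) : ℕ :=
  Nat.card {s : List ℤ // s.length = 2 * n ∧ (∀ x ∈ s, x = 1 ∨ x = -1) ∧
    (∀ k : ℕ, 0 ≤ (s.take k).sum) ∧ s.sum = 0 ∧
    (∀ k : ℕ, (s.take k).sum ≤ (h : ℤ)) ∧ (∃ k : ℕ, (s.take k).sum = (h : ℤ))}

/-- The sequences of `t` steps `±1` leading from `j` to `0` without leaving `[0, h]`. -/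
def stripPaths (h t : ℕ) (j : ℤ) : Set (List ℤ) :=
  {s | s.length = t ∧ (∀ x ∈ s, x = 1 ∨ x = -1) ∧
    (∀ k : ℕ, 0 ≤ j + (s.take k).sum ∧ j + (s.take k).sum ≤ h) ∧ j + s.sum = 0}

lemma stripPaths_eq_empty {h t : ℕ} {j : ℤ} (hj : j < 0 ∨ (h : ℤ) < j) :
    stripPaths h t j = ∅ := by
  ext s
  simp only [stripPaths, Set.mem_ofPred_eq, Set.mem_empty_iff_false, iff_false]
  rintro ⟨-, -, h3, -⟩
  have := h3 0
  simp at this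
  omega

lemma stripPaths_zero {h : ℕ} {j : ℤ} :
    stripPaths h 0 j = if j = 0 then {[]} else ∅ := by
  ext s
  split_ifs with hj
  · simp only [stripPaths, Set.mem_ofPred_eq, Set.mem_singleton_iff, List.length_eq_zero_iff]
    constructor
    · exact fun h => h.1
    · rintro rfl
      simp [hj]
  · simp only [stripPaths, Set.mem_ofPred_eq, Set.mem_empty_iff_false, iff_false,
      List.length_eq_zero_iff]
    rintro ⟨rfl, -, -, h4⟩
    simp [hj] at h4

lemma cons_mem_stripPaths {h t : ℕ} {j : ℤ} (hj0 : 0 ≤ j) (hjh : j ≤ h) (x : ℤ) (s : List ℤ) :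
    x :: s ∈ stripPaths h (t + 1) j ↔ (x = 1 ∨ x = -1) ∧ s ∈ stripPaths h t (j + x) := by
  simp only [stripPaths, Set.mem_ofPred_eq, List.length_cons, List.mem_cons, List.sum_cons,
    forall_eq_or_imp, add_left_inj, add_assoc]
  constructor
  · rintro ⟨h1, ⟨h2, h2'⟩, h3, h4⟩
    refine ⟨h2, h1, h2', fun k => ?_, h4⟩
    simpa using h3 (k + 1)
  · rintro ⟨h2, h1, h2', h3, h4⟩
    refine ⟨h1, ⟨h2, h2'⟩, fun k => ?_, h4⟩
    cases k with
    | zero => simpa using ⟨hj0, hjh⟩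
    | succ k => simpa using h3 k

lemma stripPaths_succ {h t : ℕ} {j : ℤ} (hj0 : 0 ≤ j) (hjh : j ≤ h) :
    stripPaths h (t + 1) j =
      List.cons 1 '' stripPaths h t (j + 1) ∪ List.cons (-1) '' stripPaths h t (j - 1) := by
  ext s
  cases s with
  | nil => simp [stripPaths]
  | cons x s =>
    rw [cons_mem_stripPaths hj0 hjh]
    simp only [Set.mem_union, Set.mem_image, List.cons.injEq]
    constructor
    · rintro ⟨rfl | rfl, hs⟩
      · exact Or.inl ⟨s, hs, rfl, rfl⟩
      · exact Or.inr ⟨s, hs, rfl, rfl⟩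
    · rintro (⟨_, hs, rfl, rfl⟩ | ⟨_, hs, rfl, rfl⟩)
      · exact ⟨Or.inl rfl, hs⟩
      · exact ⟨Or.inr rfl, hs⟩

lemma finite_stripPaths (h t : ℕ) (j : ℤ) : (stripPaths h t j).Finite := by
  induction t generalizing j with
  | zero => rw [stripPaths_zero]; split_ifs <;> simp
  | succ t ih =>
    by_cases hj : 0 ≤ j ∧ j ≤ h
    · rw [stripPaths_succ hj.1 hj.2]
      exact ((ih _).image _).union ((ih _).image _)
    · rw [stripPaths_eq_empty (by omega)]
      exact Set.finite_empty

lemma ncard_stripPaths_succ {h t : ℕ} {j : ℤ} (hj0 : 0 ≤ j) (hjh : j ≤ h) :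
    (stripPaths h (t + 1) j).ncard =
      (stripPaths h t (j + 1)).ncard + (stripPaths h t (j - 1)).ncard := by
  rw [stripPaths_succ hj0 hjh, Set.ncard_union_eq _ ((finite_stripPaths _ _ _).image _)
    ((finite_stripPaths _ _ _).image _), Set.ncard_image_of_injective _ List.cons_injective,
    Set.ncard_image_of_injective _ List.cons_injective]
  rw [Set.disjoint_left]
  rintro _ ⟨s, -, rfl⟩ ⟨s', -, h'⟩
  simp at h'

lemma dyckCount_succ (n h : ℕ) :
    dyckCount n (h + 1) + (stripPaths h (2 * n) 0).ncard = (stripPaths (h + 1) (2 * n) 0).ncard := by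
  rw [dyckCount, ← Set.coe_ofPred, Nat.card_coe_set_eq]
  rw [← Set.ncard_sdiff_add_ncard_of_subset (s := stripPaths h (2 * n) 0)
    (t := stripPaths (h + 1) (2 * n) 0) ?_ (finite_stripPaths _ _ _)]
  · congr 2
    ext s
    simp only [stripPaths, Set.mem_ofPred_eq, Set.mem_sdiff, zero_add]
    push_cast
    constructor
    · rintro ⟨h1, h2, h3, h4, h5, k, h6⟩
      refine ⟨⟨h1, h2, fun k => ⟨h3 k, h5 k⟩, h4⟩, fun h7 => ?_⟩
      have := (h7.2.2.1 k).2
      omega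
    · rintro ⟨⟨h1, h2, h3, h4⟩, h7⟩
      refine ⟨h1, h2, fun k => (h3 k).1, h4, fun k => (h3 k).2, ?_⟩
      by_contra! h8
      refine h7 ⟨h1, h2, fun k => ⟨(h3 k).1, ?_⟩, h4⟩
      have := (h3 k).2
      have := h8 k
      omega
  · rintro s ⟨h1, h2, h3, h4⟩
    refine ⟨h1, h2, fun k => ⟨(h3 k).1, (h3 k).2.trans ?_⟩, h4⟩
    push_cast; omega

open Real Finset in
lemma sum_range_cos_mul_two_pi_div {M : ℕ} (hM : 0 < M) (j : ℤ) :
    ∑ k ∈ range M, cos (j * (k * (2 * π / M))) = if (M : ℤ) ∣ j then (M : ℝ) else 0 := by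
  have hM' : (M : ℂ) ≠ 0 := by exact_mod_cast hM.ne'
  have hprim := Complex.isPrimitiveRoot_exp M hM.ne'
  set ζ := Complex.exp (2 * π * Complex.I / M)
  have key : ∀ k : ℕ, cos (j * (k * (2 * π / M))) = (((ζ ^ j) ^ k : ℂ)).re := by
    intro k
    rw [← Complex.exp_int_mul, ← Complex.exp_nat_mul, ← Complex.exp_ofReal_mul_I_re]
    congr 2
    push_cast
    ring
  simp_rw [key]
  rw [← Complex.re_sum]
  split_ifs with hd
  · rw [(hprim.zpow_eq_one_iff_dvd j).2 hd]
    simp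
  · have h1 : ζ ^ j ≠ 1 := fun h => hd ((hprim.zpow_eq_one_iff_dvd j).1 h)
    rw [geom_sum_eq h1, ← zpow_natCast, ← zpow_mul, mul_comm, zpow_mul, zpow_natCast,
      hprim.pow_eq_one]
    simp

open Real Finset in
lemma ncard_stripPaths (h t : ℕ) (j : ℤ) (hj0 : -1 ≤ j) (hjh : j ≤ h + 1) :
    ((stripPaths h t j).ncard : ℝ) = (1 / ((h : ℝ) + 2)) * ∑ k ∈ range (2 * (h + 2)),
      sin (k * (π / (h + 2))) * sin ((j + 1) * (k * (π / (h + 2)))) *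
        (2 * cos (k * (π / (h + 2)))) ^ t := by
  have hh : (h : ℝ) + 2 ≠ 0 := by positivity
  induction t generalizing j with
  | zero =>
    have e : ∀ k : ℕ, sin (k * (π / (h + 2))) * sin ((j + 1) * (k * (π / (h + 2)))) *
        (2 * cos (k * (π / (h + 2)))) ^ 0 =
        (cos ((j : ℤ) * (k * (2 * π / (2 * (h + 2) : ℕ)))) -
          cos ((j + 2 : ℤ) * (k * (2 * π / (2 * (h + 2) : ℕ))))) / 2 := by
      intro k
      have : (2 * π / (2 * (h + 2) : ℕ)) = π / (h + 2) := by push_cast; field_simp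
      rw [this, cos_sub_cos]
      push_cast
      set θ := k * (π / ((h : ℝ) + 2))
      rw [show (j * θ + (j + 2) * θ) / 2 = (j + 1) * θ by ring,
        show (j * θ - (j + 2) * θ) / 2 = -θ by ring, sin_neg]
      ring
    simp_rw [e]
    rw [← sum_div, sum_sub_distrib, sum_range_cos_mul_two_pi_div (by omega),
      sum_range_cos_mul_two_pi_div (by omega), stripPaths_zero]
    have h2 : ¬ (((2 * (h + 2) : ℕ) : ℤ) ∣ j + 2) := fun hd => by
      have := Int.le_of_dvd (by omega) hd
      push_cast at this
      omega
    rw [if_neg h2]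
    by_cases hj : j = 0
    · subst hj
      simp
      field_simp
    · have h1 : ¬ (((2 * (h + 2) : ℕ) : ℤ) ∣ j) := fun hd => by
        rcases lt_or_gt_of_ne hj with h0 | h0
        · have := Int.le_of_dvd (by omega) ((dvd_neg).2 hd)
          push_cast at this
          omega
        · have := Int.le_of_dvd (by omega) hd
          push_cast at this
          omega
      rw [if_neg h1, if_neg hj]
      simp
  | succ t ih =>
    rcases eq_or_lt_of_le hj0 with rfl | hj0
    · rw [stripPaths_eq_empty (Or.inl (by norm_num))]
      simp
    rcases eq_or_lt_of_le hjh with rfl | hjh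
    · rw [stripPaths_eq_empty (Or.inr (by omega))]
      rw [sum_eq_zero, Set.ncard_empty]
      · simp
      · intro k _
        rw [show (((h : ℤ) + 1 : ℤ) + 1 : ℝ) * (k * (π / (h + 2))) = k * π by
          push_cast; field_simp; ring, sin_nat_mul_pi]
        simp
    rw [ncard_stripPaths_succ (by omega) (by omega), Nat.cast_add, ih _ (by omega) (by omega),
      ih _ (by omega) (by omega), ← mul_add, ← sum_add_distrib]
    congr 1
    refine sum_congr rfl fun k _ => ?_
    set θ := k * (π / ((h : ℝ) + 2))
    push_cast
    rw [show ((j : ℝ) + 1 + 1) * θ = (j + 1) * θ + θ by ring,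
      show ((j : ℝ) - 1 + 1) * θ = (j + 1) * θ - θ by ring, sin_add, sin_sub]
    ring

open Real Finset in
lemma ncard_stripPaths_two_mul (h n : ℕ) :
    ((stripPaths h (2 * n) 0).ncard : ℝ) = 4 ^ n * ((2 / ((h : ℝ) + 2)) *
      ∑ k ∈ Ico 1 (h + 2), sin (k * (π / (h + 2))) ^ 2 * cos (k * (π / (h + 2))) ^ (2 * n)) := by
  have hh : (h : ℝ) + 2 ≠ 0 := by positivity
  rw [ncard_stripPaths _ _ _ (by omega) (by omega), two_mul (h + 2), sum_range_add]
  have e1 : ∀ k : ℕ, sin (k * (π / (h + 2))) * sin (((0 : ℤ) + 1 : ℝ) * (k * (π / (h + 2)))) *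
        (2 * cos (k * (π / (h + 2)))) ^ (2 * n) =
      4 ^ n * (sin (k * (π / (h + 2))) ^ 2 * cos (k * (π / (h + 2))) ^ (2 * n)) := by
    intro k
    rw [mul_pow, pow_mul 2 2 n]
    norm_num
    ring
  have e2 : ∀ k : ℕ, ((h + 2 + k : ℕ) : ℝ) * (π / (h + 2)) = k * (π / (h + 2)) + π := by
    intro k; push_cast; field_simp; ring
  simp_rw [e1, e2, sin_add_pi, cos_add_pi, neg_sq, pow_mul _ 2 n, neg_sq, ← pow_mul _ 2 n]
  rw [← mul_sum, range_eq_Ico, sum_eq_sum_Ico_succ_bot (by omega)]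
  simp
  ring

section
open Real Finset

lemma cos_mul_exp_half_sq_le_one {x : ℝ} (h0 : 0 ≤ x) (h1 : x ≤ π / 2) :
    cos x * exp (x ^ 2 / 2) ≤ 1 := by
  have hd : ∀ t : ℝ, HasDerivAt (fun x => cos x * exp (x ^ 2 / 2))
      ((t * cos t - sin t) * exp (t ^ 2 / 2)) t := by
    intro t
    have h2 : HasDerivAt (fun x : ℝ => x ^ 2 / 2) t t := by
      simpa using ((hasDerivAt_id t).pow 2).div_const 2
    exact ((hasDerivAt_cos t).mul h2.exp).congr_deriv (by ring)
  have hanti : AntitoneOn (fun x => cos x * exp (x ^ 2 / 2)) (Set.Icc 0 (π / 2)) := by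
    refine antitoneOn_of_deriv_nonpos (convex_Icc _ _) (by fun_prop)
      (fun t _ => (hd t).differentiableAt.differentiableWithinAt) fun t ht => ?_
    rw [interior_Icc] at ht
    rw [(hd t).deriv]
    have hc : 0 < cos t := cos_pos_of_mem_Ioo ⟨by linarith [ht.1, pi_pos], ht.2⟩
    have := (lt_tan ht.1 ht.2).le
    rw [tan_eq_sin_div_cos, le_div_iff₀ hc] at this
    exact mul_nonpos_of_nonpos_of_nonneg (by linarith) (exp_pos _).le
  have := hanti (Set.left_mem_Icc.2 (by positivity)) ⟨h0, h1⟩ h0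
  simpa using this

lemma one_sub_le_cos_mul_exp_half_sq {x : ℝ} (h0 : 0 ≤ x) (h1 : x ≤ 1) :
    1 - x ^ 4 / 4 ≤ cos x * exp (x ^ 2 / 2) := by
  have h2 := one_sub_sq_div_two_le_cos (x := x)
  have h3 := add_one_le_exp (x ^ 2 / 2)
  have h4 : 0 ≤ 1 - x ^ 2 / 2 := by nlinarith
  calc 1 - x ^ 4 / 4 = (1 - x ^ 2 / 2) * (x ^ 2 / 2 + 1) := by ring
    _ ≤ _ := mul_le_mul h2 h3 (by positivity) (h4.trans h2)

/-- The contribution of the `k`-th eigenvalue to the number of closed paths in a strip. -/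
noncomputable def stripTerm (n m k : ℕ) : ℝ :=
  sin (k * (π / m)) ^ 2 * cos (k * (π / m)) ^ (2 * n)

lemma stripTerm_nonneg (n m k : ℕ) : 0 ≤ stripTerm n m k :=
  mul_nonneg (sq_nonneg _) (by rw [pow_mul]; positivity)

lemma stripTerm_le_one (n m k : ℕ) : stripTerm n m k ≤ 1 := by
  refine mul_le_one₀ (sin_sq_le_one _) (by rw [pow_mul]; positivity) ?_
  rw [pow_mul]
  exact pow_le_one₀ (sq_nonneg _) (cos_sq_le_one _)

lemma stripTerm_reflect {n m k : ℕ} (hm : 0 < m) (hk : k ≤ m) :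
    stripTerm n m (m - k) = stripTerm n m k := by
  have hm' : (m : ℝ) ≠ 0 := by positivity
  rw [stripTerm, Nat.cast_sub hk, show ((m : ℝ) - k) * (π / m) = π - k * (π / m) by field_simp,
    sin_pi_sub, cos_pi_sub, pow_mul, neg_sq, ← pow_mul, stripTerm]

lemma stripTerm_le {n m k : ℕ} (hm : 0 < m) (hk : 2 * k ≤ m) :
    stripTerm n m k ≤ (π / m) ^ 2 * (k ^ 2 * exp (-(k ^ 2 * (π ^ 2 * n / m ^ 2)))) := by
  have hm' : (0 : ℝ) < m := by positivity
  have hk' : 2 * (k : ℝ) ≤ m := by exact_mod_cast hk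
  set x := (k : ℝ) * (π / m) with hx
  have h0 : 0 ≤ x := by positivity
  have h1 : x ≤ π / 2 := by
    rw [hx, mul_div_assoc', div_le_div_iff₀ hm' two_pos]
    nlinarith [pi_pos]
  have hc : 0 ≤ cos x := cos_nonneg_of_mem_Icc ⟨by linarith [pi_pos], h1⟩
  have h2 : cos x ≤ exp (-(x ^ 2 / 2)) := by
    rw [exp_neg, ← one_div, le_div_iff₀ (exp_pos _)]
    exact cos_mul_exp_half_sq_le_one h0 h1
  calc stripTerm n m k ≤ x ^ 2 * exp (-(x ^ 2 / 2)) ^ (2 * n) := by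
        refine mul_le_mul ?_ (pow_le_pow_left₀ hc h2 _) (pow_nonneg hc _) (sq_nonneg _)
        exact pow_le_pow_left₀ (sin_nonneg_of_nonneg_of_le_pi h0 (by linarith [pi_pos]))
          (sin_le h0) 2
    _ = _ := by
        rw [← exp_nat_mul, hx]
        push_cast
        rw [show 2 * (n : ℝ) * -((k * (π / m)) ^ 2 / 2) = -(k ^ 2 * (π ^ 2 * n / m ^ 2)) by
          field_simp]
        ring

/-- The constant `∑ k² e⁻ᵏ`. -/
noncomputable def sqExpSum : ℝ := ∑' k : ℕ, (k : ℝ) ^ 2 * exp (-k)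

lemma summable_sq_mul_exp_neg : Summable fun k : ℕ => (k : ℝ) ^ 2 * exp (-k) := by
  simpa using summable_pow_mul_exp_neg_nat_mul 2 one_pos

lemma sum_stripTerm_le {n m j : ℕ} {c : ℝ} (hm : 0 < m) (hj : 1 ≤ j) (hc : 0 ≤ c)
    (h : ∀ k : ℕ, j ≤ k → exp (-(k ^ 2 * (π ^ 2 * n / m ^ 2))) ≤ c * exp (-k)) :
    ∑ k ∈ Ico j (m + 1 - j), stripTerm n m k ≤ 2 * ((π / m) ^ 2 * c * sqExpSum) := by
  set B : ℕ → ℝ := fun k => (π / m) ^ 2 * c * (k ^ 2 * exp (-k)) with hB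
  have hB0 : ∀ k, 0 ≤ B k := fun k => by positivity
  have hlow : ∀ k, j ≤ k → 2 * k ≤ m → stripTerm n m k ≤ B k := by
    intro k hjk hkm
    refine (stripTerm_le hm hkm).trans ?_
    simp only [hB]
    rw [mul_assoc]
    refine mul_le_mul_of_nonneg_left ?_ (by positivity)
    calc (k : ℝ) ^ 2 * exp (-(k ^ 2 * (π ^ 2 * n / m ^ 2))) ≤ k ^ 2 * (c * exp (-k)) :=
          mul_le_mul_of_nonneg_left (h k hjk) (by positivity)
      _ = _ := by ring
  have hsum : ∑ k ∈ Ico j (m + 1 - j), B k ≤ (π / m) ^ 2 * c * sqExpSum := by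
    rw [hB, ← mul_sum]
    exact mul_le_mul_of_nonneg_left
      (summable_sq_mul_exp_neg.sum_le_tsum _ fun k _ => by positivity) (by positivity)
  have hrefl : ∑ k ∈ Ico j (m + 1 - j), B (m - k) = ∑ k ∈ Ico j (m + 1 - j), B k := by
    refine sum_nbij' (fun k => m - k) (fun k => m - k) ?_ ?_ ?_ ?_ (fun _ _ => rfl) <;>
      intro k <;> simp only [mem_Ico] <;> intro hk <;> omega
  calc ∑ k ∈ Ico j (m + 1 - j), stripTerm n m k
      ≤ ∑ k ∈ Ico j (m + 1 - j), (B k + B (m - k)) := by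
        refine sum_le_sum fun k hk => ?_
        rw [mem_Ico] at hk
        rcases le_total (2 * k) m with hkm | hkm
        · linarith [hlow k hk.1 hkm, hB0 (m - k)]
        · rw [← stripTerm_reflect hm (by omega : k ≤ m)]
          linarith [hlow (m - k) (by omega) (by omega), hB0 k]
    _ ≤ _ := by rw [sum_add_distrib, hrefl]; linarith

/-- The proportion among all `4 ^ n` sequences of `2 n` steps of the Dyck paths of height at most
`m - 2`. -/
noncomputable def stripDensity (n m : ℕ) : ℝ := 2 / m * ∑ k ∈ Ico 1 m, stripTerm n m k

lemma stripDensity_nonneg (n m : ℕ) : 0 ≤ stripDensity n m :=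
  mul_nonneg (by positivity) (sum_nonneg fun _ _ => stripTerm_nonneg _ _ _)

lemma stripDensity_le_two (n m : ℕ) : stripDensity n m ≤ 2 := by
  rcases Nat.eq_zero_or_pos m with rfl | hm
  · simp [stripDensity]
  have hm' : (0 : ℝ) < m := by positivity
  have h : ∑ k ∈ Ico 1 m, stripTerm n m k ≤ m := by
    refine (sum_le_card_nsmul _ _ 1 fun _ _ => stripTerm_le_one _ _ _).trans ?_
    simp
  calc stripDensity n m ≤ 2 / m * m := mul_le_mul_of_nonneg_left h (by positivity)
    _ = 2 := by field_simp

lemma stripDensity_two {n : ℕ} (hn : n ≠ 0) : stripDensity n 2 = 0 := by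
  simp [stripDensity, stripTerm, hn]

/-- The density `stripDensity n m` divided by its asymptotic equivalent. -/
noncomputable def stripRatio (n m : ℕ) : ℝ :=
  m ^ 3 / (4 * π ^ 2) * exp (π ^ 2 * n / m ^ 2) * stripDensity n m

lemma stripDensity_eq {n m : ℕ} (hm : 0 < m) :
    stripDensity n m = 4 * π ^ 2 / m ^ 3 * exp (-(π ^ 2 * n / m ^ 2)) * stripRatio n m := by
  have hm' : (m : ℝ) ≠ 0 := by positivity
  rw [stripRatio, exp_neg]
  field_simp

lemma stripRatio_nonneg (n m : ℕ) : 0 ≤ stripRatio n m :=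
  mul_nonneg (by positivity) (stripDensity_nonneg n m)

lemma stripRatio_eq {n m : ℕ} (hm : 0 < m) : stripRatio n m =
    (m / π) ^ 2 / 2 * exp (π ^ 2 * n / m ^ 2) * ∑ k ∈ Ico 1 m, stripTerm n m k := by
  have hm' : (m : ℝ) ≠ 0 := by positivity
  rw [stripRatio, stripDensity]
  field_simp
  ring

lemma one_le_pi_sq_mul_div {n m : ℕ} (hm : 0 < m) (hmn : m ^ 2 ≤ n) :
    1 ≤ π ^ 2 * n / m ^ 2 := by
  have hm' : (0 : ℝ) < m := by positivity
  have h1 : (m : ℝ) ^ 2 ≤ n := by exact_mod_cast hmn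
  rw [one_le_div (by positivity)]
  have hpi : 1 ≤ π ^ 2 := one_le_pow₀ (by linarith [pi_gt_three])
  nlinarith

lemma stripRatio_le {n m : ℕ} (hm : 0 < m) (hmn : m ^ 2 ≤ n) :
    stripRatio n m ≤ exp 1 * sqExpSum := by
  have hm' : (0 : ℝ) < m := by positivity
  have ha := one_le_pi_sq_mul_div hm hmn
  have h := sum_stripTerm_le (n := n) (c := exp (1 - π ^ 2 * n / m ^ 2)) hm le_rfl
    (exp_pos _).le fun k hk => by
      rw [← exp_add, exp_le_exp]
      have hk' : (1 : ℝ) ≤ k := by exact_mod_cast hk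
      nlinarith [mul_nonneg (by nlinarith : (0 : ℝ) ≤ k ^ 2 - 1) (sub_nonneg.2 ha)]
  rw [Nat.add_sub_cancel] at h
  rw [stripRatio_eq hm]
  refine (mul_le_mul_of_nonneg_left h (by positivity)).trans (le_of_eq ?_)
  rw [exp_sub]
  field_simp

lemma stripRatio_sub_one_le {n m : ℕ} (hm : 4 ≤ m) (hmn : m ^ 2 ≤ n) :
    stripRatio n m ≤ 1 + sqExpSum * exp (-(π ^ 2 * n / m ^ 2)) ∧
    1 - (π / m) ^ 2 / 2 - n * (π / m) ^ 4 / 2 ≤ stripRatio n m := by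
  have hm0 : 0 < m := by omega
  have hm' : (4 : ℝ) ≤ m := by exact_mod_cast hm
  have ha := one_le_pi_sq_mul_div hm0 hmn
  have h := sum_stripTerm_le (n := n) (m := m) (j := 2)
    (c := exp (- 2 * (π ^ 2 * n / m ^ 2))) hm0 one_le_two
    (exp_pos _).le fun k hk => by
      rw [← exp_add, exp_le_exp]
      have hk' : (2 : ℝ) ≤ k := by exact_mod_cast hk
      nlinarith [mul_nonneg (by nlinarith : (0 : ℝ) ≤ k ^ 2 - 2) (sub_nonneg.2 ha)]
  have h0 : 0 ≤ ∑ k ∈ Ico 2 (m + 1 - 2), stripTerm n m k :=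
    sum_nonneg fun _ _ => stripTerm_nonneg _ _ _
  set x := π / (m : ℝ) with hx
  have hx0 : 0 < x := by positivity
  have hx1 : x ≤ 1 := by
    rw [hx, div_le_one (by linarith)]
    linarith [pi_le_four]
  have hsplit : ∑ k ∈ Ico 1 m, stripTerm n m k =
      2 * stripTerm n m 1 + ∑ k ∈ Ico 2 (m + 1 - 2), stripTerm n m k := by
    rw [sum_eq_sum_Ico_succ_bot (by omega), show Ico (1 + 1) m = Ico 2 (m - 1 + 1) by
      rw [Nat.sub_add_cancel (by omega)], sum_Ico_succ_top (by omega),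
      stripTerm_reflect hm0 (by omega), show m + 1 - 2 = m - 1 by omega]
    ring
  have hax : π ^ 2 * n / m ^ 2 = n * x ^ 2 := by rw [hx]; ring
  have hmx : ((m : ℝ) / π) ^ 2 = 1 / x ^ 2 := by rw [hx]; field_simp
  have hmain : (1 / x ^ 2) * exp (n * x ^ 2) * stripTerm n m 1 =
      (sin x / x) ^ 2 * (cos x * exp (x ^ 2 / 2)) ^ (2 * n) := by
    rw [mul_pow, ← exp_nat_mul, stripTerm, Nat.cast_one, one_mul, ← hx]
    push_cast
    rw [show 2 * (n : ℝ) * (x ^ 2 / 2) = n * x ^ 2 by ring]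
    ring
  have hs1 : sin x / x ≤ 1 := (div_le_one hx0).2 (sin_le hx0.le)
  have hs0 : 1 - x ^ 2 / 4 ≤ sin x / x := by
    rw [le_div_iff₀ hx0]
    have := sin_gt_sub_cube hx0
    nlinarith
  have hx2 : x ^ 2 ≤ 1 := by nlinarith
  have hx4 : x ^ 4 ≤ 1 := by nlinarith [sq_nonneg (x ^ 2)]
  have hsx : 0 ≤ sin x / x := le_trans (by linarith) hs0
  have hc0 := one_sub_le_cos_mul_exp_half_sq hx0.le hx1
  have hc1 := cos_mul_exp_half_sq_le_one hx0.le (by linarith [pi_gt_three])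
  have hcx : 0 ≤ cos x * exp (x ^ 2 / 2) := le_trans (by linarith) hc0
  rw [stripRatio_eq hm0, hsplit, hax, hmx, show 1 / x ^ 2 / 2 * exp (n * x ^ 2) *
    (2 * stripTerm n m 1 + ∑ k ∈ Ico 2 (m + 1 - 2), stripTerm n m k) =
    (1 / x ^ 2) * exp (n * x ^ 2) * stripTerm n m 1 +
    1 / x ^ 2 / 2 * exp (n * x ^ 2) * ∑ k ∈ Ico 2 (m + 1 - 2), stripTerm n m k by ring, hmain]
  constructor
  · refine add_le_add (mul_le_one₀ (pow_le_one₀ hsx hs1) (by positivity)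
      (pow_le_one₀ hcx hc1)) ?_
    refine (mul_le_mul_of_nonneg_left h (by positivity)).trans (le_of_eq ?_)
    rw [hax, show -2 * (n * x ^ 2) = -(n * x ^ 2) + -(n * x ^ 2) by ring, exp_add, exp_neg]
    field_simp
  · have hb : 1 - n * x ^ 4 / 2 ≤ (cos x * exp (x ^ 2 / 2)) ^ (2 * n) := by
      calc 1 - n * x ^ 4 / 2 = 1 + ((2 * n : ℕ) : ℝ) * (-(x ^ 4 / 4)) := by push_cast; ring
        _ ≤ (1 + -(x ^ 4 / 4)) ^ (2 * n) := one_add_mul_le_pow (by linarith) _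
        _ ≤ _ := pow_le_pow_left₀ (by linarith) (by linarith) _
    have hs2 : 1 - x ^ 2 / 2 ≤ (sin x / x) ^ 2 := by nlinarith
    have hc2 := pow_le_one₀ hcx hc1 (n := 2 * n)
    have hc3 := pow_nonneg hcx (2 * n)
    have hrem : 0 ≤ 1 / x ^ 2 / 2 * exp (n * x ^ 2) *
        ∑ k ∈ Ico 2 (m + 1 - 2), stripTerm n m k := mul_nonneg (by positivity) h0
    have hs3 := pow_le_one₀ hsx hs1 (n := 2)
    nlinarith

lemma tendsto_stripRatio {ι : Type*} {l : Filter ι} {N m : ι → ℕ}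
    (hm : Tendsto (fun i => (m i : ℝ)) l atTop)
    (h2 : Tendsto (fun i => (N i : ℝ) / m i ^ 2) l atTop)
    (h4 : Tendsto (fun i => (N i : ℝ) / m i ^ 4) l (nhds 0)) :
    Tendsto (fun i => stripRatio (N i) (m i)) l (nhds 1) := by
  have e1 : ∀ᶠ i in l, 4 ≤ m i ∧ m i ^ 2 ≤ N i := by
    filter_upwards [hm.eventually_ge_atTop 4, h2.eventually_ge_atTop 1] with i h1 h2
    have h1' : (0 : ℝ) < m i := by linarith
    rw [le_div_iff₀ (by positivity), one_mul] at h2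
    exact ⟨by exact_mod_cast h1, by exact_mod_cast h2⟩
  have hup : Tendsto (fun i => 1 + sqExpSum * exp (-(π ^ 2 * N i / m i ^ 2))) l
      (nhds (1 + sqExpSum * 0)) := by
    refine ((tendsto_exp_neg_atTop_nhds_zero.comp ?_).const_mul _).const_add _
    simpa only [mul_div_assoc] using h2.const_mul_atTop (by positivity : (0 : ℝ) < π ^ 2)
  have hlo : Tendsto (fun i => 1 - (π / m i) ^ 2 / 2 - N i * (π / m i) ^ 4 / 2) l
      (nhds (1 - 0 ^ 2 / 2 - π ^ 4 * 0 / 2)) := by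
    refine ((((hm.const_div_atTop π).pow 2).div_const 2).const_sub 1).sub
      (((h4.const_mul (π ^ 4)).div_const 2).congr fun i => by ring)
  rw [mul_zero, add_zero] at hup
  norm_num at hlo
  refine tendsto_of_tendsto_of_tendsto_of_le_of_le' hlo hup ?_ ?_
  · filter_upwards [e1] with i hi using (stripRatio_sub_one_le hi.1 hi.2).2
  · filter_upwards [e1] with i hi using (stripRatio_sub_one_le hi.1 hi.2).1

end

section
open Real MeasureTheory Topology

lemma integral_ite_natFloor_mem {S : Finset ℕ} (hS : 0 ∉ S) (g : ℕ → ℝ) :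
    ∫ u : ℝ, (if ⌊u⌋₊ ∈ S then g ⌊u⌋₊ else 0) = ∑ m ∈ S, g m := by
  have h : (fun u : ℝ => if ⌊u⌋₊ ∈ S then g ⌊u⌋₊ else 0) =
      fun u => ∑ m ∈ S, (Set.Ico (m : ℝ) (m + 1)).indicator (fun _ => g m) u := by
    ext u
    have : ∀ m ∈ S, (Set.Ico (m : ℝ) (m + 1)).indicator (fun _ => g m) u =
        if ⌊u⌋₊ = m then g m else 0 := by
      intro m hm
      have hm0 : m ≠ 0 := fun h => hS (h ▸ hm)
      simp only [Set.indicator_apply, Set.mem_Ico, Nat.floor_eq_iff' hm0]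
    rw [Finset.sum_congr rfl this, Finset.sum_ite_eq]
  rw [h, integral_finsetSum]
  · refine Finset.sum_congr rfl fun m _ => ?_
    rw [integral_indicator_const _ measurableSet_Ico]
    simp [Measure.real]
  · intro m _
    exact (integrable_indicator_iff measurableSet_Ico).2 (integrableOn_const (by simp))

lemma sum_eq_mul_integral_natFloor {S : Finset ℕ} (hS : 0 ∉ S) (g : ℕ → ℝ) (a : ℝ) {b : ℝ}
    (hb : 0 < b) :
    ∑ m ∈ S, g m =
      b * ∫ s : ℝ, (if ⌊a + b * s⌋₊ ∈ S then g ⌊a + b * s⌋₊ else 0) := by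
  rw [← integral_ite_natFloor_mem hS g,
    Measure.integral_comp_mul_left (fun u => if ⌊a + u⌋₊ ∈ S then g ⌊a + u⌋₊ else 0) b,
    integral_add_left_eq_self (fun u => if ⌊u⌋₊ ∈ S then g ⌊u⌋₊ else 0) a, smul_eq_mul,
    abs_of_pos (inv_pos.2 hb), mul_inv_cancel_left₀ hb.ne']

/-- The saddle point kernel in the rescaled coordinates `x = m / N`, `σ = (m - N) / √N`. -/
noncomputable def saddleKernel (r x σ : ℝ) : ℝ :=
  x⁻¹ ^ 3 * exp (-(r * σ ^ 2 * (x⁻¹ + x⁻¹ ^ 2 / 2)))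

lemma saddleKernel_le {r x σ : ℝ} (hr : 0 < r) (hx : 0 < x) (h : |x - 1| ≤ |σ|) :
    saddleKernel r x σ ≤ (8 + 128 / r ^ 2) * exp r * exp (-(r * |σ|)) := by
  obtain ⟨h1, h2⟩ := abs_le.1 h
  set z := x⁻¹ with hz
  have hz0 : 0 < z := inv_pos.2 hx
  have hxz : x * z = 1 := mul_inv_cancel₀ hx.ne'
  have hσ := abs_nonneg σ
  have hσ2 := sq_abs σ
  have hlin : |σ| - 1 ≤ σ ^ 2 * z := by
    have : 1 ≤ z * (1 + |σ|) := by nlinarith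
    rcases le_total |σ| 1 with h | h
    · exact le_trans (by linarith) (by positivity : 0 ≤ σ ^ 2 * z)
    · have := mul_le_mul_of_nonneg_left this (sub_nonneg.2 h)
      nlinarith
  have hcube : z ^ 3 * exp (-(r * σ ^ 2 * (z ^ 2 / 2))) ≤ 8 + 128 / r ^ 2 := by
    rcases le_total z 2 with hz2 | hz2
    · have h3 : z ^ 3 ≤ 2 ^ 3 := pow_le_pow_left₀ hz0.le hz2 3
      have h4 : exp (-(r * σ ^ 2 * (z ^ 2 / 2))) ≤ 1 := exp_le_one_iff.2 (by
        rw [neg_nonpos]; positivity)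
      have h5 : 0 ≤ 128 / r ^ 2 := by positivity
      nlinarith [mul_le_mul h3 h4 (exp_pos _).le (by norm_num)]
    · have hx2 : x ≤ 1 / 2 := by nlinarith
      have hs4 : 1 / 4 ≤ σ ^ 2 := by nlinarith
      have h3 : (r * z ^ 2 / 8) ^ 2 / 2 ≤ exp (r * z ^ 2 / 8) := by
        have h30 : 0 ≤ r * z ^ 2 / 8 := by positivity
        linarith [quadratic_le_exp_of_nonneg h30]
      have h4 : exp (-(r * σ ^ 2 * (z ^ 2 / 2))) ≤ exp (-(r * z ^ 2 / 8)) := by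
        rw [exp_le_exp]
        have : 0 ≤ r * z ^ 2 := by positivity
        nlinarith
      calc z ^ 3 * exp (-(r * σ ^ 2 * (z ^ 2 / 2)))
          ≤ z ^ 3 * exp (-(r * z ^ 2 / 8)) := by gcongr
        _ ≤ 128 / r ^ 2 := by
            rw [exp_neg, ← div_eq_mul_inv, div_le_div_iff₀ (exp_pos _) (by positivity)]
            have h5 : z ^ 3 ≤ z ^ 4 := pow_le_pow_right₀ (by linarith) (by norm_num)
            have h6 := mul_le_mul_of_nonneg_right h5 (sq_nonneg r)
            nlinarith
        _ ≤ _ := by linarith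
  calc saddleKernel r x σ
      = z ^ 3 * exp (-(r * σ ^ 2 * (z ^ 2 / 2))) * exp (-(r * (σ ^ 2 * z))) := by
        rw [saddleKernel, ← hz, mul_assoc (z ^ 3), ← exp_add]
        ring_nf
    _ ≤ (8 + 128 / r ^ 2) * exp (-(r * (|σ| - 1))) := by
        gcongr
    _ = _ := by
        rw [mul_assoc, ← exp_add]
        ring_nf

lemma tendsto_saddleKernel {ι : Type*} {l : Filter ι} {x σ : ι → ℝ} {s : ℝ} (r : ℝ)
    (hx : Tendsto x l (𝓝 1)) (hσ : Tendsto σ l (𝓝 s)) :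
    Tendsto (fun i => saddleKernel r (x i) (σ i)) l (𝓝 (exp (-(3 * r / 2) * s ^ 2))) := by
  have hz : Tendsto (fun i => (x i)⁻¹) l (𝓝 1) := by simpa using hx.inv₀ one_ne_zero
  have := (hz.pow 3).mul (((hσ.pow 2).const_mul r).mul (hz.add ((hz.pow 2).div_const 2))).neg.rexp
  refine this.congr' ?_ |>.trans (le_of_eq ?_)
  · exact Eventually.of_forall fun i => rfl
  · congr 1
    ring_nf

lemma exp_mul_stripDensity_eq {r N : ℝ} {n m : ℕ} (hN : 0 < N) (hm : 0 < m)
    (h : r * N ^ 3 = 2 * π ^ 2 * n) :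
    N ^ 3 / (4 * π ^ 2) * exp (3 * r * N / 2) * (exp (-(r * m)) * stripDensity n m) =
      saddleKernel r (m / N) ((m - N) / √N) * stripRatio n m := by
  have hm' : (0 : ℝ) < m := by positivity
  have hn : π ^ 2 * (n : ℝ) / m ^ 2 = r * N ^ 3 / 2 / m ^ 2 := by rw [h]; ring
  have he : -(r * ((m - N) / √N) ^ 2 * ((m / N : ℝ)⁻¹ + (m / N : ℝ)⁻¹ ^ 2 / 2)) =
      3 * r * N / 2 + -(r * m) + -(π ^ 2 * n / m ^ 2) := by
    rw [hn, div_pow, sq_sqrt hN.le]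
    field_simp
    ring
  rw [stripDensity_eq hm, saddleKernel, he, exp_add, exp_add]
  field_simp

lemma integrable_exp_neg_mul_abs {r : ℝ} (hr : 0 < r) :
    Integrable fun s : ℝ => exp (-(r * |s|)) := by
  refine (integrable_inv_one_add_sq.comp_mul_left' (by positivity : r / 2 ≠ 0)).mono'
    (by fun_prop) (Eventually.of_forall fun s => ?_)
  have h0 : 0 ≤ r * |s| := by positivity
  rw [norm_of_nonneg (exp_pos _).le, exp_neg]
  refine inv_anti₀ (by positivity) (le_trans ?_ (quadratic_le_exp_of_nonneg h0))
  have : (r * |s|) ^ 2 = (r * s) ^ 2 := by rw [mul_pow, sq_abs, mul_pow]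
  rw [this]
  nlinarith [sq_nonneg (r * s)]

lemma abs_natFloor_sub_div_sqrt_sub_le {N s : ℝ} (hN : 0 < N) (hm : 0 < ⌊N + √N * s⌋₊) :
    |(⌊N + √N * s⌋₊ - N) / √N - s| ≤ (√N)⁻¹ := by
  have hs : 0 < √N := sqrt_pos.2 hN
  have h1 : (⌊N + √N * s⌋₊ : ℝ) ≤ N + √N * s := by
    refine Nat.floor_le (le_of_lt ?_)
    by_contra! h
    rw [Nat.floor_of_nonpos h] at hm
    exact lt_irrefl _ hm
  have h2 := Nat.lt_floor_add_one (N + √N * s)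
  have e : (⌊N + √N * s⌋₊ - N) / √N - s = (⌊N + √N * s⌋₊ - (N + √N * s)) / √N := by
    field_simp
    ring
  rw [e, abs_div, abs_of_pos hs, inv_eq_one_div]
  gcongr
  rw [abs_le]
  constructor <;> linarith

/-- The rescaled summand, as a step function on the line. -/
noncomputable def saddleStep (r : ℝ) (N : ℕ → ℝ) (n : ℕ) (s : ℝ) : ℝ :=
  if ⌊N n + √(N n) * s⌋₊ ∈ Finset.Icc 2 n.sqrt then
    saddleKernel r (⌊N n + √(N n) * s⌋₊ / N n) ((⌊N n + √(N n) * s⌋₊ - N n) / √(N n)) *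
      stripRatio n ⌊N n + √(N n) * s⌋₊
  else 0

lemma norm_saddleStep_le {r : ℝ} (hr : 0 < r) {N : ℕ → ℝ} {n : ℕ} (hN : 1 ≤ N n) (s : ℝ) :
    ‖saddleStep r N n s‖ ≤ (8 + 128 / r ^ 2) * exp r * exp r * (exp 1 * sqExpSum) *
      exp (-(r * |s|)) := by
  have hK : 0 ≤ sqExpSum := tsum_nonneg fun k => by positivity
  rw [saddleStep]
  split_ifs with hmem
  swap
  · rw [norm_zero]; positivity
  rw [Finset.mem_Icc] at hmem
  have hfl := abs_natFloor_sub_div_sqrt_sub_le (s := s) (by linarith : 0 < N n) (by omega)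
  set m := ⌊N n + √(N n) * s⌋₊
  have hm : 0 < m := by omega
  have hmn : m ^ 2 ≤ n := by
    rw [pow_two]; exact Nat.le_sqrt.1 hmem.2
  have hs1 : 1 ≤ √(N n) := one_le_sqrt.2 hN
  have hx : (0 : ℝ) < m / N n := by positivity
  set σ := ((m : ℝ) - N n) / √(N n) with hσ
  have hxσ : (m : ℝ) / N n - 1 = σ / √(N n) := by
    rw [hσ, div_div, mul_self_sqrt (by linarith)]
    field_simp
  have habs : |(m : ℝ) / N n - 1| ≤ |σ| := by
    rw [hxσ, abs_div, abs_of_pos (by linarith : 0 < √(N n))]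
    exact div_le_self (abs_nonneg _) hs1
  have h1 : |s| ≤ |σ| + 1 := by
    have h2 : (√(N n))⁻¹ ≤ 1 := inv_le_one_of_one_le₀ hs1
    have h3 := abs_sub_abs_le_abs_sub s σ
    rw [abs_sub_comm] at h3
    linarith
  have h2 : exp (-(r * |σ|)) ≤ exp r * exp (-(r * |s|)) := by
    rw [← exp_add, exp_le_exp]
    nlinarith
  have hk0 : 0 ≤ saddleKernel r (m / N n) σ := by rw [saddleKernel]; positivity
  rw [norm_of_nonneg (mul_nonneg hk0 (stripRatio_nonneg _ _))]
  calc saddleKernel r (m / N n) σ * stripRatio n m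
      ≤ (8 + 128 / r ^ 2) * exp r * exp (-(r * |σ|)) * (exp 1 * sqExpSum) :=
        mul_le_mul (saddleKernel_le hr hx habs) (stripRatio_le hm hmn) (stripRatio_nonneg _ _)
          (by positivity)
    _ ≤ (8 + 128 / r ^ 2) * exp r * (exp r * exp (-(r * |s|))) * (exp 1 * sqExpSum) := by
        gcongr
    _ = _ := by ring

lemma tendsto_saddleStep {r : ℝ} (hr : 0 < r) {N : ℕ → ℝ} (hN : Tendsto N atTop atTop)
    (h : ∀ n, r * N n ^ 3 = 2 * π ^ 2 * n) (s : ℝ) :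
    Tendsto (fun n => saddleStep r N n s) atTop (𝓝 (exp (-(3 * r / 2) * s ^ 2))) := by
  set m : ℕ → ℕ := fun n => ⌊N n + √(N n) * s⌋₊ with hm
  have hsq : Tendsto (fun n => √(N n)) atTop atTop := tendsto_sqrt_atTop.comp hN
  have hpos : ∀ᶠ n in atTop, 0 < N n := hN.eventually_gt_atTop 0
  have hmtop : Tendsto m atTop atTop := by
    refine tendsto_nat_floor_atTop.comp ?_
    refine (hsq.atTop_mul_atTop₀ (tendsto_atTop_add_const_right _ s hsq)).congr' ?_
    filter_upwards [hpos] with n hn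
    rw [mul_add, mul_self_sqrt hn.le]
  have hmtop' : Tendsto (fun n => (m n : ℝ)) atTop atTop := tendsto_natCast_atTop_atTop.comp hmtop
  have hσ : Tendsto (fun n => (m n - N n) / √(N n)) atTop (𝓝 s) := by
    rw [tendsto_iff_norm_sub_tendsto_zero]
    refine squeeze_zero' (Eventually.of_forall fun _ => norm_nonneg _) ?_
      (tendsto_inv_atTop_zero.comp hsq)
    filter_upwards [hpos, hmtop.eventually_gt_atTop 0] with n h1 h2
    exact abs_natFloor_sub_div_sqrt_sub_le h1 h2
  have hx : Tendsto (fun n => m n / N n) atTop (𝓝 1) := by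
    have := (hσ.div_atTop hsq).const_add 1
    rw [add_zero] at this
    refine this.congr' ?_
    filter_upwards [hpos] with n hn
    rw [div_div, mul_self_sqrt hn.le]
    field_simp
    ring
  have hz : Tendsto (fun n => (m n / N n)⁻¹) atTop (𝓝 1) := by simpa using hx.inv₀ one_ne_zero
  have hn_eq : ∀ n : ℕ, (n : ℝ) = r / (2 * π ^ 2) * N n ^ 3 := by
    intro n
    field_simp
    linarith [h n]
  have h2 : Tendsto (fun n : ℕ => (n : ℝ) / m n ^ 2) atTop atTop := by
    have := ((hz.pow 2).pos_mul_atTop (by norm_num) hN).const_mul_atTop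
      (by positivity : 0 < r / (2 * π ^ 2))
    refine this.congr' ?_
    filter_upwards [hpos, hmtop'.eventually_gt_atTop 0] with n h1 h2
    rw [hn_eq n]
    field_simp
  have h4 : Tendsto (fun n : ℕ => (n : ℝ) / m n ^ 4) atTop (𝓝 0) := by
    have := ((hz.pow 4).mul (tendsto_inv_atTop_zero.comp hN)).const_mul (r / (2 * π ^ 2))
    rw [mul_zero, mul_zero] at this
    refine this.congr' ?_
    filter_upwards [hpos, hmtop'.eventually_gt_atTop 0] with n h1 h2
    rw [hn_eq n]
    simp only [Function.comp]
    field_simp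
  have hlim := (tendsto_saddleKernel r hx hσ).mul (tendsto_stripRatio hmtop' h2 h4)
  rw [mul_one] at hlim
  refine hlim.congr' ?_
  filter_upwards [hmtop.eventually_ge_atTop 2, h2.eventually_ge_atTop 1] with n h5 h6
  have h7 : (0 : ℝ) < m n := by
    have : 0 < m n := by omega
    exact_mod_cast this
  rw [le_div_iff₀ (by positivity), one_mul] at h6
  have h8 : m n ^ 2 ≤ n := by exact_mod_cast h6
  rw [saddleStep, if_pos (Finset.mem_Icc.2 ⟨h5, Nat.le_sqrt.2 (by rwa [← pow_two])⟩)]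

lemma tendsto_sum_stripDensity {r : ℝ} (hr : 0 < r) {N : ℕ → ℝ} (hN : Tendsto N atTop atTop)
    (h : ∀ n, r * N n ^ 3 = 2 * π ^ 2 * n) :
    Tendsto (fun n => N n ^ 3 / (4 * π ^ 2) * exp (3 * r * N n / 2) / √(N n) *
        ∑ m ∈ Finset.Icc 2 n.sqrt, exp (-(r * m)) * stripDensity n m)
      atTop (𝓝 √(2 * π / (3 * r))) := by
  have hlim : Tendsto (fun n => ∫ s, saddleStep r N n s) atTop
      (𝓝 (∫ s, exp (-(3 * r / 2) * s ^ 2))) := by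
    refine tendsto_integral_filter_of_dominated_convergence
      (fun s => (8 + 128 / r ^ 2) * exp r * exp r * (exp 1 * sqExpSum) * exp (-(r * |s|)))
      (Eventually.of_forall fun n => Measurable.aestronglyMeasurable ?_) ?_
      ((integrable_exp_neg_mul_abs hr).const_mul _)
      (Eventually.of_forall fun s => tendsto_saddleStep hr hN h s)
    · have hfl : Measurable fun s : ℝ => ⌊N n + √(N n) * s⌋₊ :=
        Nat.measurable_floor.comp (by fun_prop)
      exact (measurable_from_nat (f := fun m : ℕ => if m ∈ Finset.Icc 2 n.sqrt then
        saddleKernel r (m / N n) ((m - N n) / √(N n)) * stripRatio n m else 0)).comp hfl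
    · filter_upwards [hN.eventually_ge_atTop 1] with n hn
      exact Eventually.of_forall fun s => norm_saddleStep_le hr hn s
  rw [integral_gaussian, show π / (3 * r / 2) = 2 * π / (3 * r) by field_simp] at hlim
  refine hlim.congr' ?_
  filter_upwards [hN.eventually_gt_atTop 0] with n hn
  have hs : 0 < √(N n) := sqrt_pos.2 hn
  have := sum_eq_mul_integral_natFloor (S := Finset.Icc 2 n.sqrt) (by simp)
    (fun m => saddleKernel r (m / N n) ((m - N n) / √(N n)) * stripRatio n m) (N n) hs
  rw [div_mul_eq_mul_div, Finset.mul_sum, eq_div_iff hs.ne', mul_comm]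
  refine this.symm.trans (Finset.sum_congr rfl fun m hm => ?_)
  rw [Finset.mem_Icc] at hm
  exact (exp_mul_stripDensity_eq hn (by omega) (h n)).symm

end

section
open Real Finset Topology

lemma ncard_stripPaths_eq_stripDensity (h n : ℕ) :
    ((stripPaths h (2 * n) 0).ncard : ℝ) = 4 ^ n * stripDensity n (h + 2) := by
  rw [ncard_stripPaths_two_mul, stripDensity]
  simp only [stripTerm, Nat.cast_add, Nat.cast_ofNat]

lemma dyckCount_succ_eq (n h : ℕ) :
    (dyckCount n (h + 1) : ℝ) =
      4 ^ n * stripDensity n (h + 3) - 4 ^ n * stripDensity n (h + 2) := by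
  rw [← ncard_stripPaths_eq_stripDensity h n, ← ncard_stripPaths_eq_stripDensity (h + 1) n,
    ← dyckCount_succ]
  push_cast
  ring

lemma sum_range_sub_mul_pow (D : ℕ → ℝ) (y : ℝ) (H : ℕ) :
    ∑ h ∈ range H, (D (h + 1) - D h) * y ^ (h + 1) =
      (1 - y) * ∑ h ∈ range H, D h * y ^ h + y ^ H * D H - D 0 := by
  induction H with
  | zero => simp
  | succ H ih => rw [sum_range_succ, ih, sum_range_succ]; ring

lemma sum_range_sub_mul_pow_sub_mem {D : ℕ → ℝ} (hD0 : D 0 = 0) (hD : Monotone D) {y : ℝ}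
    (hy0 : 0 ≤ y) (hy1 : y ≤ 1) {H n : ℕ} (hn : H ≤ n) :
    ∑ h ∈ range n, (D (h + 1) - D h) * y ^ (h + 1) - (1 - y) * ∑ h ∈ range H, D h * y ^ h ∈
      Set.Icc 0 (y ^ H * D n) := by
  have h0 : ∀ h, 0 ≤ D (h + 1) - D h := fun h => sub_nonneg.2 (hD h.le_succ)
  rw [← sum_range_add_sum_Ico _ hn, sum_range_sub_mul_pow, hD0]
  have h1 : 0 ≤ ∑ h ∈ Ico H n, (D (h + 1) - D h) * y ^ (h + 1) :=
    sum_nonneg fun h _ => mul_nonneg (h0 h) (by positivity)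
  have h2 : ∑ h ∈ Ico H n, (D (h + 1) - D h) * y ^ (h + 1) ≤ y ^ H * (D n - D H) := by
    rw [← sum_Ico_sub _ hn, mul_sum]
    refine sum_le_sum fun h hh => ?_
    rw [mul_comm]
    refine mul_le_mul_of_nonneg_right (pow_le_pow_of_le_one hy0 hy1 ?_) (h0 h)
    have := (mem_Ico.1 hh).1
    omega
  have h3 : 0 ≤ y ^ H * D H := mul_nonneg (by positivity) (hD0 ▸ hD H.zero_le)
  constructor <;> linarith

lemma sum_dyckCount_mul_pow_sub_mem {n : ℕ} (hn : n ≠ 0) {y : ℝ} (hy0 : 0 < y) (hy1 : y ≤ 1) :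
    ∑ h ∈ Icc 1 n, (dyckCount n h : ℝ) * y ^ h -
      (1 - y) / y ^ 2 * 4 ^ n * ∑ m ∈ Icc 2 n.sqrt, y ^ m * stripDensity n m ∈
      Set.Icc 0 (2 * 4 ^ n * y ^ (n.sqrt - 1)) := by
  set D : ℕ → ℝ := fun h => 4 ^ n * stripDensity n (h + 2) with hD
  have hmono : Monotone D := monotone_nat_of_le_succ fun h => by
    have := dyckCount_succ_eq n h
    have h0 : (0 : ℝ) ≤ dyckCount n (h + 1) := Nat.cast_nonneg _
    simp only [hD]
    rw [show h + 1 + 2 = h + 3 by ring]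
    linarith
  have hsum : ∑ h ∈ Icc 1 n, (dyckCount n h : ℝ) * y ^ h =
      ∑ h ∈ range n, (D (h + 1) - D h) * y ^ (h + 1) := by
    rw [← Ico_succ_right_eq_Icc, range_eq_Ico, Nat.succ_eq_succ, Nat.succ_eq_add_one,
      ← sum_Ico_add' _ 0 n 1]
    refine sum_congr rfl fun h _ => ?_
    rw [dyckCount_succ_eq]
  have hmain : (1 - y) / y ^ 2 * 4 ^ n * ∑ m ∈ Icc 2 n.sqrt, y ^ m * stripDensity n m =
      (1 - y) * ∑ h ∈ range (n.sqrt - 1), D h * y ^ h := by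
    have : ∑ m ∈ Icc 2 n.sqrt, y ^ m * stripDensity n m =
        ∑ h ∈ range (n.sqrt - 1), y ^ (h + 2) * stripDensity n (h + 2) := by
      symm
      refine sum_nbij' (· + 2) (· - 2) ?_ ?_ ?_ ?_ (fun _ _ => rfl) <;>
        intro k <;> simp only [mem_Icc, mem_range] <;> intro hk <;> omega
    rw [this, mul_assoc, div_mul_eq_mul_div, mul_div_assoc, mul_sum, sum_div]
    congr 1
    refine sum_congr rfl fun h _ => ?_
    simp only [hD]
    field_simp
    ring
  rw [hsum, hmain]
  have hle : n.sqrt - 1 ≤ n := (Nat.sub_le _ _).trans (Nat.sqrt_le_self n)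
  obtain ⟨h1, h2⟩ := sum_range_sub_mul_pow_sub_mem (D := D) (by simp [hD, stripDensity_two hn])
    hmono hy0.le hy1 hle
  refine ⟨h1, h2.trans ?_⟩
  have := stripDensity_le_two n (n + 2)
  calc y ^ (n.sqrt - 1) * D n ≤ y ^ (n.sqrt - 1) * (4 ^ n * 2) := by
        simp only [hD]; gcongr
    _ = _ := by ring

/-- The location of the saddle point. -/
noncomputable def saddlePoint (r : ℝ) (n : ℕ) : ℝ := (2 * π ^ 2 * n / r) ^ ((1 : ℝ) / 3)

lemma mul_saddlePoint_pow {r : ℝ} (hr : 0 < r) (n : ℕ) :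
    r * saddlePoint r n ^ 3 = 2 * π ^ 2 * n := by
  rw [saddlePoint, ← rpow_natCast, ← rpow_mul (by positivity)]
  norm_num
  field_simp

lemma tendsto_saddlePoint {r : ℝ} (hr : 0 < r) : Tendsto (saddlePoint r) atTop atTop := by
  refine (tendsto_rpow_atTop (by norm_num : (0 : ℝ) < 1 / 3)).comp ?_
  exact (tendsto_natCast_atTop_atTop.const_mul_atTop (by positivity)).atTop_div_const hr

lemma exponent_eq_saddlePoint {r : ℝ} (hr : 0 < r) {n : ℕ} (hn : n ≠ 0) :
    -(3 * (π / 2) ^ ((2 : ℝ) / 3)) * r ^ ((2 : ℝ) / 3) * (n : ℝ) ^ ((1 : ℝ) / 3) =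
      -(3 * r * saddlePoint r n / 2) := by
  have hn' : (0 : ℝ) < n := by positivity
  have : 2 * ((π / 2) ^ ((2 : ℝ) / 3) * r ^ ((2 : ℝ) / 3) * (n : ℝ) ^ ((1 : ℝ) / 3)) =
      r * saddlePoint r n := by
    rw [saddlePoint]
    refine log_injOn_pos (by rw [Set.mem_Ioi]; positivity) (by rw [Set.mem_Ioi]; positivity) ?_
    rw [log_mul (by positivity) (by positivity), log_mul (by positivity) (by positivity),
      log_mul (by positivity) (by positivity), log_mul (by positivity) (by positivity),
      log_rpow (by positivity), log_rpow (by positivity), log_rpow (by positivity),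
      log_rpow (by positivity), log_div (by positivity) (by positivity),
      log_div (by positivity) (by positivity), log_mul (by positivity) (by positivity),
      log_mul (by positivity) (by positivity), log_pow]
    push_cast
    ring
  linarith

lemma amplitude_eq_saddlePoint {r : ℝ} (hr : 0 < r) {n : ℕ} (hn : n ≠ 0) :
    r ^ ((1 : ℝ) / 3) * (2 ^ ((5 : ℝ) / 3) * π ^ ((5 : ℝ) / 6) / √3) * (n : ℝ) ^ (-(5 : ℝ) / 6) =
      4 * π ^ 2 / saddlePoint r n ^ 3 * √(saddlePoint r n) * √(2 * π / (3 * r)) := by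
  have hn' : (0 : ℝ) < n := by positivity
  rw [saddlePoint]
  refine log_injOn_pos (by rw [Set.mem_Ioi]; positivity) (by rw [Set.mem_Ioi]; positivity) ?_
  have h4 : log 4 = 2 * log 2 := by
    rw [show (4 : ℝ) = 2 ^ 2 by norm_num, log_pow]
    norm_num
  simp only [sqrt_eq_rpow]
  rw [log_mul (by positivity) (by positivity), log_mul (by positivity) (by positivity),
    log_div (by positivity) (by positivity), log_mul (by positivity) (by positivity),
    log_mul (by positivity) (by positivity), log_mul (by positivity) (by positivity),
    log_div (by positivity) (by positivity), log_mul (by positivity) (by positivity),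
    log_rpow (by positivity), log_rpow (by positivity), log_rpow (by positivity),
    log_rpow (by positivity), log_rpow (by positivity), log_rpow (by positivity),
    log_rpow (by positivity), log_pow, log_pow, log_rpow (by positivity),
    log_rpow (by positivity), log_div (by positivity) (by positivity),
    log_div (by positivity) (by positivity),
    log_mul (by positivity) (by positivity), log_mul (by positivity) (by positivity),
    log_mul (by positivity) (by positivity), log_mul (by positivity) (by positivity), log_pow, h4]
  push_cast
  ring

lemma tendsto_pow_sqrt_mul_exp_saddlePoint {r : ℝ} (hr : 0 < r) :
    Tendsto (fun n : ℕ => exp (-r) ^ (n.sqrt - 1) *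
      (saddlePoint r n ^ 3 * exp (3 * r * saddlePoint r n / 2) / √(saddlePoint r n)))
      atTop (𝓝 0) := by
  have hN := tendsto_saddlePoint hr
  have hlim := ((tendsto_rpow_mul_exp_neg_mul_atTop_nhds_zero 3 r hr).comp hN).const_mul
    (exp (2 * r))
  rw [mul_zero] at hlim
  refine squeeze_zero' (Eventually.of_forall fun n => ?_) ?_ hlim
  · have : 0 ≤ saddlePoint r n := by rw [saddlePoint]; positivity
    positivity
  filter_upwards [hN.eventually_ge_atTop 1, hN.eventually_ge_atTop (25 * π ^ 2 / (2 * r))]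
    with n h1 h2
  have hpow := mul_saddlePoint_pow hr n
  simp only [Function.comp]
  set N := saddlePoint r n
  have hsqrt : 5 / 2 * N ≤ √n := by
    refine le_sqrt_of_sq_le ?_
    rw [div_le_iff₀ (by positivity)] at h2
    have h3 := mul_le_mul_of_nonneg_right h2 (sq_nonneg N)
    have h4 : π ^ 2 * (25 * N ^ 2) ≤ π ^ 2 * (4 * n) := by nlinarith
    have := le_of_mul_le_mul_left h4 (by positivity)
    nlinarith
  have hH : √n - 2 ≤ ((n.sqrt - 1 : ℕ) : ℝ) := by
    have h3 : √n < n.sqrt + 1 := by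
      rw [sqrt_lt' (by positivity)]
      exact_mod_cast Nat.lt_succ_sqrt' n
    have h4 : (n.sqrt : ℝ) ≤ (n.sqrt - 1 : ℕ) + 1 := by
      have : n.sqrt ≤ n.sqrt - 1 + 1 := by omega
      exact_mod_cast this
    linarith
  rw [← exp_nat_mul]
  calc exp ((n.sqrt - 1 : ℕ) * -r) * (N ^ 3 * exp (3 * r * N / 2) / √N)
      ≤ exp ((n.sqrt - 1 : ℕ) * -r) * (N ^ 3 * exp (3 * r * N / 2)) := by
        gcongr
        exact div_le_self (by positivity) (one_le_sqrt.2 h1)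
    _ = N ^ 3 * exp ((n.sqrt - 1 : ℕ) * -r + 3 * r * N / 2) := by
        rw [exp_add]; ring
    _ ≤ N ^ 3 * exp (2 * r + -r * N) :=
        mul_le_mul_of_nonneg_left (exp_le_exp.2 (by nlinarith)) (by positivity)
    _ = exp (2 * r) * (N ^ (3 : ℝ) * exp (-r * N)) := by
        rw [exp_add, show (3 : ℝ) = (3 : ℕ) by norm_num, rpow_natCast]
        ring

end

/-- Asymptotics of Dyck paths counted by height: for fixed `0 < y < 1`, with
`r = -log y`, `A = 2^(5/3) π^(5/6) / √3` and `E = 3 (π/2)^(2/3)`,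
`∑_{h=1}^n d_{n,h} y^h ~ ((1-y)/y²) r^(1/3) A ⬝ 4ⁿ ⬝ exp(-E r^(2/3) n^(1/3)) ⬝ n^(-5/6)`. -/
theorem stmt_19 (y : ℝ) (hy0 : 0 < y) (hy1 : y < 1) :
    Tendsto (fun n : ℕ =>
        (∑ h ∈ Finset.Icc 1 n, (dyckCount n h : ℝ) * y ^ h) /
          (((1 - y) / y ^ 2) * (-Real.log y) ^ ((1 : ℝ) / 3) *
            (2 ^ ((5 : ℝ) / 3) * Real.pi ^ ((5 : ℝ) / 6) / Real.sqrt 3) * 4 ^ n *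
            Real.exp (-(3 * (Real.pi / 2) ^ ((2 : ℝ) / 3)) * (-Real.log y) ^ ((2 : ℝ) / 3) *
              (n : ℝ) ^ ((1 : ℝ) / 3)) *
            (n : ℝ) ^ (-(5 : ℝ) / 6)))
      atTop (nhds 1) := by
  set r := -Real.log y with hr_def
  have hr : 0 < r := neg_pos.2 (Real.log_neg hy0 hy1)
  have hy : Real.exp (-r) = y := by rw [hr_def, neg_neg, Real.exp_log hy0]
  have hc : 0 < √(2 * Real.pi / (3 * r)) := by positivity
  have hmain := (tendsto_sum_stripDensity hr (tendsto_saddlePoint hr)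
    (mul_saddlePoint_pow hr)).div_const √(2 * Real.pi / (3 * r))
  have herr := (tendsto_pow_sqrt_mul_exp_saddlePoint hr).const_mul
    (2 * y ^ 2 / ((1 - y) * (4 * Real.pi ^ 2) * √(2 * Real.pi / (3 * r))))
  rw [div_self hc.ne'] at hmain
  rw [mul_zero] at herr
  have hup := hmain.add herr
  rw [add_zero] at hup
  have hy1' : 0 < 1 - y := sub_pos.2 hy1
  have hexp : ∀ m : ℕ, Real.exp (-(r * m)) = y ^ m := fun m => by
    rw [← hy, ← Real.exp_nat_mul]
    ring_nf
  have hden : ∀ n : ℕ, n ≠ 0 →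
      ((1 - y) / y ^ 2) * r ^ ((1 : ℝ) / 3) *
        (2 ^ ((5 : ℝ) / 3) * Real.pi ^ ((5 : ℝ) / 6) / Real.sqrt 3) * 4 ^ n *
        Real.exp (-(3 * (Real.pi / 2) ^ ((2 : ℝ) / 3)) * r ^ ((2 : ℝ) / 3) *
          (n : ℝ) ^ ((1 : ℝ) / 3)) * (n : ℝ) ^ (-(5 : ℝ) / 6) =
      (1 - y) / y ^ 2 * 4 ^ n * (4 * Real.pi ^ 2 / saddlePoint r n ^ 3 * √(saddlePoint r n) *
        √(2 * Real.pi / (3 * r)) * (Real.exp (3 * r * saddlePoint r n / 2))⁻¹) := by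
    intro n hn
    rw [← amplitude_eq_saddlePoint hr hn, exponent_eq_saddlePoint hr hn, Real.exp_neg]
    ring
  have hpos : ∀ᶠ n in atTop, 0 < saddlePoint r n :=
    (tendsto_saddlePoint hr).eventually_gt_atTop 0
  refine tendsto_of_tendsto_of_tendsto_of_le_of_le' hmain hup ?_ ?_
  · filter_upwards [hpos, eventually_ne_atTop 0] with n hN hn
    have h := (sum_dyckCount_mul_pow_sub_mem hn hy0 hy1.le).1
    rw [hden n hn, le_div_iff₀ (by positivity)]
    simp_rw [hexp]
    refine le_trans (le_of_eq ?_) (sub_nonneg.1 h)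
    field_simp
  · filter_upwards [hpos, eventually_ne_atTop 0] with n hN hn
    have h := (sum_dyckCount_mul_pow_sub_mem hn hy0 hy1.le).2
    rw [hden n hn, div_le_iff₀ (by positivity)]
    simp_rw [hexp]
    rw [hy]
    refine (sub_le_iff_le_add.1 h).trans (le_of_eq ?_)
    field_simp
    ring
end
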